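/- arXiv:1901.01796 — 3 statements merged into one kernel-verified Lean document; each statement's English description precedes it below -/
import Mathlib

section
/- Let T ∈ S⁸ ℂ³ be a nonzero ternary form of degree 8 and let A ⊆ ℙ²(ℂ) be a non-redundant finite set computing T with ℓ(A) = 14, k₃(A) = 10, and h_A(4) = 14. Let B ⊆ ℙ²(ℂ) be another non-redundant finite set computing T with ℓ(B) = 14 and B ≠ A. Then Z = A ∪ B satisfies the Cayley–Bacharach property CB(8). -/
open MvPolynomial

noncomputable section

/-- Projective n-space over ℂ, viewed as classes of linear forms (vectors in ℂ^{n+1}). -/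
abbrev Proj (n : ℕ) := Projectivization ℂ (Fin (n + 1) → ℂ)

instance (n : ℕ) : DecidableEq (Proj n) := Classical.decEq _

/-- The linear form with coefficient vector `v`. -/
def linForm (n : ℕ) (v : Fin (n + 1) → ℂ) : MvPolynomial (Fin (n + 1)) ℂ :=
  ∑ i, MvPolynomial.C (v i) * MvPolynomial.X i

/-- The `d`-th Veronese image of a projective point: the `d`-th power of (a representative of)
the corresponding linear form. -/
def vero (n d : ℕ) (P : Proj n) : MvPolynomial (Fin (n + 1)) ℂ :=
  linForm n P.rep ^ d

/-- `A` computes `T` : the class of `T` lies in the projective linear span of `v_d(A)`,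
equivalently `T` lies in the linear span of the `d`-th powers of the points of `A`. -/
def Computes (n d : ℕ) (A : Finset (Proj n)) (T : MvPolynomial (Fin (n + 1)) ℂ) : Prop :=
  T ∈ Submodule.span ℂ (vero n d '' (A : Set (Proj n)))

/-- `A` is a non-redundant set computing `T`. -/
def NRComputes (n d : ℕ) (A : Finset (Proj n)) (T : MvPolynomial (Fin (n + 1)) ℂ) : Prop :=
  Computes n d A T ∧ ∀ A' ⊂ A, ¬ Computes n d A' T

/-- The (Waring) rank of `T` : minimal cardinality of a finite set computing `T`. -/
def waringRank (n d : ℕ) (T : MvPolynomial (Fin (n + 1)) ℂ) : ℕ :=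
  sInf {r | ∃ A : Finset (Proj n), A.card = r ∧ Computes n d A T}

/-- `T` is identifiable: there is exactly one finite set computing `T` whose
cardinality equals the rank of `T`. -/
def Identifiable (n d : ℕ) (T : MvPolynomial (Fin (n + 1)) ℂ) : Prop :=
  ∃! A : Finset (Proj n), A.card = waringRank n d T ∧ Computes n d A T

/-- The evaluation map of degree `j` on the chosen homogeneous coordinates of `Z`. -/
def evalMap (n j : ℕ) (Z : Finset (Proj n)) :
    MvPolynomial.homogeneousSubmodule (Fin (n + 1)) ℂ j →ₗ[ℂ] (Z → ℂ) where
  toFun F := fun P => MvPolynomial.eval (P.1).rep F.1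
  map_add' F G := by funext P; simp
  map_smul' c F := by funext P; simp

/-- The Hilbert function of the finite set `Z` (at a natural number `j`). -/
def hilbN (n : ℕ) (Z : Finset (Proj n)) (j : ℕ) : ℕ :=
  Module.finrank ℂ (LinearMap.range (evalMap n j Z))

/-- The Hilbert function of the finite set `Z` (zero in negative degrees). -/
def hilb (n : ℕ) (Z : Finset (Proj n)) (j : ℤ) : ℕ :=
  if j < 0 then 0 else hilbN n Z j.toNat

/-- The first difference of the Hilbert function. -/
def Dhilb (n : ℕ) (Z : Finset (Proj n)) (j : ℤ) : ℤ :=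
  (hilb n Z j : ℤ) - (hilb n Z (j - 1) : ℤ)

/-- The `d`-th Kruskal rank of `A` : the largest `k` such that every subset of `A`
with at most `k` elements has linearly independent image under `v_d`. -/
def kruskalRank (n d : ℕ) (A : Finset (Proj n)) : ℕ :=
  sSup {k | k ≤ A.card ∧
    ∀ A' ⊆ A, A'.card ≤ k → LinearIndependent ℂ (fun P : A' => vero n d P.1)}

/-- The Cayley–Bacharach property in degree `d` for the finite set `Z`. -/
def CB (n d : ℕ) (Z : Finset (Proj n)) : Prop :=
  ∀ P ∈ Z, ∀ F : MvPolynomial (Fin (n + 1)) ℂ, F.IsHomogeneous d →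
    (∀ Q ∈ Z, Q ≠ P → MvPolynomial.eval Q.rep F = 0) → MvPolynomial.eval P.rep F = 0

end

namespace S9

theorem finrank_hom (d : ℕ) :
    Module.finrank ℂ (homogeneousSubmodule (Fin 3) ℂ d) = (d + 2).choose 2 := by
  have h : homogeneousSubmodule (Fin 3) ℂ d
      = restrictSupport ℂ (((Finset.univ : Finset (Fin 3)).finsuppAntidiag d : Finset _) :
        Set (Fin 3 →₀ ℕ)) := by
    rw [homogeneousSubmodule_eq_finsupp_supported]
    unfold restrictSupport
    congr 1
    ext x
    simp [Finset.mem_finsuppAntidiag, Finsupp.degree_eq_sum]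
  rw [h, Module.finrank_eq_nat_card_basis (basisRestrictSupport ℂ _)]
  rw [Nat.card_coe_set_eq, Set.ncard_coe_finset]
  rw [Finset.card_finsuppAntidiag_nat_eq_choose]
  rw [Finset.card_univ, Fintype.card_fin, show 3 + d - 1 = d + 2 by omega]
  exact Nat.choose_symm_of_eq_add rfl

instance (d : ℕ) : FiniteDimensional ℂ (homogeneousSubmodule (Fin 3) ℂ d) :=
  Module.Finite.iff_fg.mpr (homogeneousSubmodule_fg (Fin 3) ℂ d)

instance (d : ℕ) : FiniteDimensional ℂ (homogeneousSubmodule (Fin (2 + 1)) ℂ d) :=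
  Module.Finite.iff_fg.mpr (homogeneousSubmodule_fg (Fin 3) ℂ d)

/-- homogenisation by an extra variable -/
noncomputable def phi : MvPolynomial (Fin 3) ℂ →ₐ[ℂ] Polynomial (MvPolynomial (Fin 3) ℂ) :=
  MvPolynomial.aeval (fun i => Polynomial.C (X i) * Polynomial.X)

theorem phi_monomial (s : Fin 3 →₀ ℕ) (c : ℂ) :
    phi (monomial s c) = Polynomial.monomial s.degree (monomial s c) := by
  rw [phi, aeval_monomial]
  simp only [mul_pow, Finsupp.prod_mul]
  rw [← Polynomial.C_mul_X_pow_eq_monomial]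
  have : (s.prod fun _ e => (Polynomial.X : Polynomial (MvPolynomial (Fin 3) ℂ)) ^ e)
      = Polynomial.X ^ s.degree := by
    rw [Finsupp.prod, Finset.prod_pow_eq_pow_sum]; rfl
  rw [this, ← mul_assoc, monomial_eq]
  congr 1
  rw [map_mul, Finsupp.prod, Finsupp.prod, map_prod]
  simp only [map_pow]
  rfl

theorem phi_coeff (p : MvPolynomial (Fin 3) ℂ) (k : ℕ) :
    (phi p).coeff k = homogeneousComponent k p := by
  induction p using MvPolynomial.induction_on' with
  | monomial s c =>
    rw [phi_monomial, Polynomial.coeff_monomial]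
    rw [homogeneousComponent_of_mem (m := k) ((mem_homogeneousSubmodule s.degree _).2
      (isHomogeneous_monomial c rfl))]
    simp [eq_comm]
  | add p q hp hq => simp [hp, hq]

theorem phi_hom {p : MvPolynomial (Fin 3) ℂ} {n : ℕ} (h : p.IsHomogeneous n) :
    phi p = Polynomial.monomial n p := by
  ext1 k
  rw [phi_coeff, Polynomial.coeff_monomial,
    homogeneousComponent_of_mem ((mem_homogeneousSubmodule n _).2 h)]
  simp [eq_comm]

theorem phi_ne {p : MvPolynomial (Fin 3) ℂ} (h : p ≠ 0) : phi p ≠ 0 := by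
  intro h0
  apply h
  rw [← sum_homogeneousComponent p]
  apply Finset.sum_eq_zero
  intro i _
  rw [← phi_coeff, h0]; simp

theorem hom_of_phi {p : MvPolynomial (Fin 3) ℂ}
    (h : (phi p).natTrailingDegree = (phi p).natDegree) :
    p.IsHomogeneous (phi p).natDegree := by
  have : homogeneousComponent (phi p).natDegree p = p := by
    conv_rhs => rw [← sum_homogeneousComponent p]
    by_cases hp : p = 0
    · subst hp; simp
    · rw [Finset.sum_eq_single]
      · intro b _ hb
        rw [← phi_coeff]
        rcases lt_or_gt_of_ne hb with h1 | h1
        · exact Polynomial.coeff_eq_zero_of_lt_natTrailingDegree (h ▸ h1)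
        · exact Polynomial.coeff_eq_zero_of_natDegree_lt h1
      · intro hn
        apply homogeneousComponent_eq_zero
        simpa using hn
  have h2 := homogeneousComponent_isHomogeneous (phi p).natDegree p
  rwa [this] at h2

theorem hom_factor {p q : MvPolynomial (Fin 3) ℂ} {n : ℕ} (h : (p * q).IsHomogeneous n)
    (hp : p ≠ 0) (hq : q ≠ 0) :
    ∃ a b, a + b = n ∧ p.IsHomogeneous a ∧ q.IsHomogeneous b := by
  have h1 := phi_hom h
  have hpq : p * q ≠ 0 := mul_ne_zero hp hq
  rw [map_mul] at h1
  have hd := congrArg Polynomial.natDegree h1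
  have ht := congrArg Polynomial.natTrailingDegree h1
  rw [Polynomial.natDegree_mul (phi_ne hp) (phi_ne hq), Polynomial.natDegree_monomial_eq _ hpq] at hd
  rw [Polynomial.natTrailingDegree_mul (phi_ne hp) (phi_ne hq),
    Polynomial.natTrailingDegree_monomial hpq] at ht
  have e1 := Polynomial.natTrailingDegree_le_natDegree (phi p)
  have e2 := Polynomial.natTrailingDegree_le_natDegree (phi q)
  exact ⟨_, _, hd, hom_of_phi (by omega), hom_of_phi (by omega)⟩

/-- `W` imposes independent conditions in degree `d`. -/
def Indep (W : Finset (Proj 2)) (d : ℕ) : Prop :=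
  ∀ g : Proj 2 → ℂ, ∃ F : MvPolynomial (Fin 3) ℂ, F.IsHomogeneous d ∧
    ∀ P ∈ W, eval P.rep F = g P

theorem Indep.mono {W W' : Finset (Proj 2)} {d : ℕ} (h : Indep W d) (hs : W' ⊆ W) :
    Indep W' d := fun g => by
  obtain ⟨F, h1, h2⟩ := h g
  exact ⟨F, h1, fun P hP => h2 P (hs hP)⟩

theorem Indep.surj {W : Finset (Proj 2)} {d : ℕ} (h : Indep W d) :
    LinearMap.range (evalMap 2 d W) = ⊤ := by
  rw [LinearMap.range_eq_top]
  intro g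
  obtain ⟨F, h1, h2⟩ := h (fun P => if hP : P ∈ W then g ⟨P, hP⟩ else 0)
  refine ⟨⟨F, h1⟩, ?_⟩
  funext P
  have := h2 P.1 P.2
  simpa [evalMap] using this

theorem indep_of_surj {W : Finset (Proj 2)} {d : ℕ}
    (h : LinearMap.range (evalMap 2 d W) = ⊤) : Indep W d := by
  rw [LinearMap.range_eq_top] at h
  intro g
  obtain ⟨F, hF⟩ := h (fun P => g P.1)
  exact ⟨F.1, F.2, fun P hP => congrFun hF ⟨P, hP⟩⟩

theorem indep_of_hilb {W : Finset (Proj 2)} {d : ℕ} (h : hilbN 2 W d = W.card) : Indep W d := by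
  apply indep_of_surj
  apply Submodule.eq_top_of_finrank_eq
  rw [Module.finrank_fintype_fun_eq_card, Fintype.card_coe]
  exact h

theorem Indep.card_le {W : Finset (Proj 2)} {d : ℕ} (h : Indep W d)
    (V : Submodule ℂ (homogeneousSubmodule (Fin 3) ℂ d))
    (hV : ∀ F ∈ V, ∀ P ∈ W, eval P.rep F.1 = 0) :
    W.card + Module.finrank ℂ V ≤ (d + 2).choose 2 := by
  have h1 := LinearMap.finrank_range_add_finrank_ker (evalMap 2 d W)
  rw [h.surj, finrank_top, Module.finrank_fintype_fun_eq_card, Fintype.card_coe] at h1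
  have h2 : V ≤ LinearMap.ker (evalMap 2 d W) := by
    intro F hF
    rw [LinearMap.mem_ker]
    funext P
    exact hV F hF P.1 P.2
  have h3 := Submodule.finrank_mono h2
  have h4 := finrank_hom d
  exact le_trans (Nat.add_le_add_left h3 _) (le_of_eq (h1.trans h4))

/-- multiplication by a form -/
noncomputable def mulMap (D : MvPolynomial (Fin 3) ℂ) (e k m : ℕ) (hD : D.IsHomogeneous e) (hm : e + k = m) :
    homogeneousSubmodule (Fin 3) ℂ k →ₗ[ℂ] homogeneousSubmodule (Fin 3) ℂ m where
  toFun F := ⟨D * F.1, hm ▸ hD.mul F.2⟩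
  map_add' F G := by ext1; simp [mul_add]
  map_smul' c F := by ext1; simp

theorem curve_bound {D : MvPolynomial (Fin 3) ℂ} {e : ℕ} (k : ℕ) (hD : D.IsHomogeneous e)
    (hD0 : D ≠ 0) {W : Finset (Proj 2)} (hW : ∀ P ∈ W, eval P.rep D = 0)
    (hi : Indep W (e + k)) : W.card + (k + 2).choose 2 ≤ (e + k + 2).choose 2 := by
  have h1 := hi.card_le (LinearMap.range (mulMap D e k _ hD rfl)) (by
    rintro _ ⟨F, rfl⟩ P hP
    simp [mulMap, hW P hP])
  rw [LinearMap.finrank_range_of_inj, finrank_hom] at h1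
  · exact h1
  · intro F G h
    have := congrArg Subtype.val h
    exact Subtype.ext (mul_left_cancel₀ hD0 this)

theorem koszul_bound {H1 H2 : MvPolynomial (Fin 3) ℂ} {f : ℕ} (k : ℕ) (h1 : H1.IsHomogeneous f)
    (h2 : H2.IsHomogeneous f) (h20 : H2 ≠ 0) (hr : IsRelPrime H1 H2)
    {W : Finset (Proj 2)} (hW1 : ∀ P ∈ W, eval P.rep H1 = 0)
    (hW2 : ∀ P ∈ W, eval P.rep H2 = 0) (hi : Indep W (f + k)) :
    W.card + 2 * (k + 2).choose 2 ≤ (f + k + 2).choose 2 + (k + 2 - f).choose 2 := by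
  set Ψ := (mulMap H1 f k _ h1 rfl).coprod (mulMap H2 f k _ h2 rfl) with hΨ
  have hb := hi.card_le (LinearMap.range Ψ) (by
    rintro _ ⟨F, rfl⟩ P hP
    simp [hΨ, mulMap, hW1 P hP, hW2 P hP])
  have hrn := LinearMap.finrank_range_add_finrank_ker Ψ
  rw [Module.finrank_prod, finrank_hom] at hrn
  suffices hk : Module.finrank ℂ (LinearMap.ker Ψ) ≤ (k + 2 - f).choose 2 by omega
  have key : ∀ U V : MvPolynomial (Fin 3) ℂ, U.IsHomogeneous k → H1 * U + H2 * V = 0 →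
      ∃ w, U = H2 * w ∧ V = - (H1 * w) := by
    intro U V hU hUV
    have hd : H2 ∣ H1 * U := ⟨-V, by linear_combination hUV⟩
    obtain ⟨w, hw⟩ := hr.symm.dvd_of_dvd_mul_left hd
    refine ⟨w, hw, mul_left_cancel₀ h20 ?_⟩
    rw [hw] at hUV
    linear_combination hUV
  have hdeg : ∀ w : MvPolynomial (Fin 3) ℂ, (H2 * w).IsHomogeneous k → w ≠ 0 →
      f ≤ k ∧ w.IsHomogeneous (k - f) := by
    intro w hw hw0
    obtain ⟨a, b, hab, ha, hb⟩ := hom_factor hw h20 hw0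
    have : a = f := ha.inj_right h2 h20
    subst this
    refine ⟨by omega, ?_⟩
    have : k - a = b := by omega
    rwa [this]
  rcases lt_or_ge k f with hkf | hkf
  · have : LinearMap.ker Ψ = ⊥ := by
      rw [LinearMap.ker_eq_bot']
      rintro ⟨U, V⟩ h0
      have h0' : H1 * U.1 + H2 * V.1 = 0 := congrArg Subtype.val h0
      obtain ⟨w, hw, hw'⟩ := key _ _ U.2 h0'
      by_cases hw0 : w = 0
      · subst hw0
        have a1 : U = 0 := Subtype.ext (by simpa using hw)
        have a2 : V = 0 := Subtype.ext (by simpa using hw')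
        rw [a1, a2]; rfl
      · have := hdeg w (hw ▸ U.2) hw0
        omega
    rw [this, finrank_bot]; exact Nat.zero_le _
  · set Θ := (mulMap H2 f (k - f) k h2 (by omega)).prod (-(mulMap H1 f (k - f) k h1 (by omega)))
      with hΘ
    have hle : LinearMap.ker Ψ ≤ LinearMap.range Θ := by
      rintro ⟨U, V⟩ h0
      have h0' : H1 * U.1 + H2 * V.1 = 0 := congrArg Subtype.val h0
      obtain ⟨w, hw, hw'⟩ := key _ _ U.2 h0'
      have hwh : w.IsHomogeneous (k - f) := by
        by_cases hw0 : w = 0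
        · subst hw0; exact isHomogeneous_zero _ _ _
        · exact (hdeg w (hw ▸ U.2) hw0).2
      refine ⟨⟨w, hwh⟩, ?_⟩
      apply Prod.ext
      · exact Subtype.ext hw.symm
      · exact Subtype.ext hw'.symm
    have e1 := Submodule.finrank_mono hle
    have e2 := LinearMap.finrank_range_le Θ
    rw [finrank_hom] at e2
    have : k - f + 2 = k + 2 - f := by omega
    rw [this] at e2
    omega

theorem sep_one {P Q : Proj 2} (h : Q ≠ P) : ∃ F : MvPolynomial (Fin 3) ℂ,
    F.IsHomogeneous 1 ∧ eval Q.rep F = 0 ∧ eval P.rep F ≠ 0 := by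
  have hn : P.rep ∉ Submodule.span ℂ {Q.rep} := by
    intro hm
    rw [Submodule.mem_span_singleton] at hm
    obtain ⟨c, hc⟩ := hm
    apply h
    rw [← P.mk_rep, ← Q.mk_rep, Projectivization.mk_eq_mk_iff']
    have hc0 : c ≠ 0 := by
      rintro rfl
      exact P.rep_nonzero (by rw [← hc]; simp)
    exact ⟨c⁻¹, by rw [← hc, smul_smul, inv_mul_cancel₀ hc0, one_smul]⟩
  obtain ⟨φ, h1, h2⟩ := Submodule.exists_le_ker_of_notMem hn
  have he : ∀ v : Fin 3 → ℂ, eval v (∑ i, C (φ (Pi.single i 1)) * X i) = φ v := by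
    intro v
    conv_rhs => rw [LinearMap.pi_apply_eq_sum_univ φ v]
    simp only [map_sum, map_mul, eval_C, eval_X, smul_eq_mul]
    apply Finset.sum_congr rfl
    intro i _
    rw [mul_comm]
    congr 2
    ext j; simp [Pi.single_apply, eq_comm]
  refine ⟨∑ i, C (φ (Pi.single i 1)) * X i, ?_, ?_, ?_⟩
  · exact IsHomogeneous.sum _ _ _ fun i _ => isHomogeneous_C_mul_X _ _
  · rw [he]
    exact h2 (Submodule.mem_span_singleton_self _)
  · rw [he]; exact h1

theorem nonzero_one (P : Proj 2) : ∃ F : MvPolynomial (Fin 3) ℂ,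
    F.IsHomogeneous 1 ∧ eval P.rep F ≠ 0 := by
  obtain ⟨i, hi⟩ := Function.ne_iff.1 P.rep_nonzero
  exact ⟨X i, isHomogeneous_X _ _, by simpa using hi⟩

theorem sep (S : Finset (Proj 2)) (P : Proj 2) (d : ℕ) (hP : P ∉ S) (hS : S.card ≤ d) :
    ∃ F : MvPolynomial (Fin 3) ℂ,
    F.IsHomogeneous d ∧ (∀ Q ∈ S, eval Q.rep F = 0) ∧ eval P.rep F ≠ 0 := by
  classical
  induction S using Finset.induction_on generalizing d with
  | empty =>
    obtain ⟨F, h1, h2⟩ := nonzero_one P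
    refine ⟨F ^ d, by simpa using h1.pow d, by simp, ?_⟩
    rw [map_pow]; exact pow_ne_zero _ h2
  | insert Q S hQ ih =>
    rw [Finset.card_insert_of_notMem hQ] at hS
    rw [Finset.mem_insert, not_or] at hP
    obtain ⟨F, h1, h2, h3⟩ := ih (d - 1) hP.2 (by omega)
    obtain ⟨L, l1, l2, l3⟩ := sep_one (Ne.symm hP.1)
    refine ⟨F * L, ?_, ?_, ?_⟩
    · have := h1.mul l1
      rwa [Nat.sub_add_cancel (by omega)] at this
    · intro R hR
      rw [Finset.mem_insert] at hR
      rcases hR with rfl | hR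
      · simp [l2]
      · simp [h2 R hR]
    · rw [map_mul]; exact mul_ne_zero h3 l3

theorem indep_of_card {W : Finset (Proj 2)} {d : ℕ} (h : W.card ≤ d + 1) : Indep W d := by
  classical
  intro g
  have : ∀ P : Proj 2, ∃ F : MvPolynomial (Fin 3) ℂ, F.IsHomogeneous d ∧ (P ∈ W →
      (∀ Q ∈ W.erase P, eval Q.rep F = 0) ∧ eval P.rep F = g P) := by
    intro P
    by_cases hP : P ∈ W
    · obtain ⟨F, h1, h2, h3⟩ := sep (W.erase P) P d (by simp) (by
        rw [Finset.card_erase_of_mem hP]; omega)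
      refine ⟨C (g P / eval P.rep F) * F, h1.C_mul _, fun _ => ⟨?_, ?_⟩⟩
      · intro Q hQ; simp [h2 Q hQ]
      · simp [h3]
    · exact ⟨0, isHomogeneous_zero _ _ _, fun h => absurd h hP⟩
  choose F h1 h2 using this
  refine ⟨∑ P ∈ W, F P, IsHomogeneous.sum _ _ _ fun P _ => h1 P, ?_⟩
  intro P hP
  rw [map_sum, Finset.sum_eq_single P]
  · exact (h2 P hP).2
  · intro Q hQ hne
    exact (h2 Q hQ).1 P (Finset.mem_erase.2 ⟨Ne.symm hne, hP⟩)
  · intro h; exact absurd hP h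

theorem vero_coeff (d : ℕ) (P : Proj 2) (s : Fin 3 →₀ ℕ) :
    coeff s (vero 2 d P) = if s.degree = d then
      (s.multinomial : ℂ) * ∏ i, P.rep i ^ s i else 0 := by
  have h := coeff_linearCombination_X_pow_of_fintype (R := ℂ) P.rep s d
  have e : vero 2 d P = (∑ i, P.rep i • X i) ^ d := by
    simp [vero, linForm, smul_eq_C_mul]
  rw [e, h]
  simp [Finsupp.degree_eq_sum, Finsupp.sum_fintype, Finsupp.prod_fintype]

theorem multi_ne (s : Fin 3 →₀ ℕ) : (s.multinomial : ℂ) ≠ 0 := by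
  have : 0 < s.multinomial := by
    rw [Finsupp.multinomial_eq]; exact Nat.multinomial_pos _ _
  exact_mod_cast this.ne'

theorem exists_dual {d : ℕ} {F : MvPolynomial (Fin 3) ℂ} (hF : F.IsHomogeneous d) :
    ∃ ψ : MvPolynomial (Fin 3) ℂ →ₗ[ℂ] ℂ, ∀ P, ψ (vero 2 d P) = eval P.rep F := by
  refine ⟨∑ s ∈ F.support, (coeff s F / (s.multinomial : ℂ)) • lcoeff ℂ s, ?_⟩
  intro P
  rw [eval_eq']
  simp only [LinearMap.sum_apply, LinearMap.smul_apply, lcoeff_apply, smul_eq_mul]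
  apply Finset.sum_congr rfl
  intro s hs
  rw [vero_coeff, if_pos (by
    by_contra hne
    exact (mem_support_iff.1 hs) (hF.coeff_eq_zero hne))]
  have := multi_ne s
  field_simp

theorem indep_of_li {W : Finset (Proj 2)} {d : ℕ}
    (h : LinearIndependent ℂ (fun P : W => vero 2 d P.1)) : Indep W d := by
  apply indep_of_surj
  by_contra hne
  obtain ⟨φ, h1, h2⟩ := Submodule.exists_le_ker_of_lt_top _ (lt_top_iff_ne_top.2 hne)
  apply h1
  have hφ : ∀ v : W → ℂ, φ v = ∑ i, v i * φ (fun j => if i = j then 1 else 0) := by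
    intro v
    conv_lhs => rw [LinearMap.pi_apply_eq_sum_univ φ v]
    simp
  rw [Fintype.linearIndependent_iff] at h
  have h3 := h (fun i => φ (fun j => if i = j then 1 else 0)) (by
    refine MvPolynomial.ext _ _ fun (s : Fin 3 →₀ ℕ) => ?_
    have hv : ∀ P : W, coeff (σ := Fin (2 + 1)) s (vero 2 d P.1) = if s.degree = d then
      (s.multinomial : ℂ) * ∏ i, P.1.rep i ^ s i else 0 := fun P => vero_coeff d P.1 s
    simp only [coeff_sum, coeff_smul, hv, coeff_zero, smul_eq_mul]
    by_cases hs : s.degree = d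
    · simp only [hs, if_true]
      have hm : (⟨monomial s 1, isHomogeneous_monomial 1 hs⟩ :
        homogeneousSubmodule (Fin 3) ℂ d) ∈ LinearMap.ker (φ ∘ₗ evalMap 2 d W) := by
        rw [LinearMap.mem_ker]
        exact h2 ⟨_, rfl⟩
      rw [LinearMap.mem_ker, LinearMap.comp_apply, hφ] at hm
      simp only [evalMap, LinearMap.coe_mk, AddHom.coe_mk, eval_monomial, one_mul] at hm
      have := congrArg (fun z => (s.multinomial : ℂ) * z) hm
      simp only [mul_zero, Finset.mul_sum] at this
      refine Eq.trans ?_ this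
      apply Finset.sum_congr rfl
      intro i _
      rw [Finsupp.prod_fintype _ _ (by simp)]
      ring
    · simp [hs])
  ext1 i
  apply LinearMap.ext
  intro v
  rw [LinearMap.comp_apply, LinearMap.comp_apply, hφ]
  apply Finset.sum_eq_zero
  intro j _
  rw [h3 j, mul_zero]

theorem card_bound {W : Finset (Proj 2)} (b : ℕ) (hb : b < 10)
    (h : ∀ W' ⊆ W, W'.card ≤ 10 → W'.card ≤ b) : W.card ≤ b := by
  by_contra hc
  push Not at hc
  obtain ⟨W', h1, h2⟩ := Finset.exists_subset_card_eq (show b + 1 ≤ W.card by omega)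
  have := h W' h1 (by omega)
  omega

theorem two_quartics {B : Finset (Proj 2)} (hB : B.card = 13) :
    ∃ G1 G2 : MvPolynomial (Fin 3) ℂ, G1.IsHomogeneous 4 ∧ G2.IsHomogeneous 4 ∧ G1 ≠ 0 ∧
      (∀ c : ℂ, G2 ≠ C c * G1) ∧ (∀ P ∈ B, eval P.rep G1 = 0) ∧ (∀ P ∈ B, eval P.rep G2 = 0) := by
  have h1 := LinearMap.finrank_range_add_finrank_ker (evalMap 2 4 B)
  have h2 := Submodule.finrank_le (LinearMap.range (evalMap 2 4 B))
  rw [Module.finrank_fintype_fun_eq_card, Fintype.card_coe, hB] at h2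
  have h3 : Module.finrank ℂ (homogeneousSubmodule (Fin (2 + 1)) ℂ 4) = 15 := finrank_hom 4
  rw [h3] at h1
  have h4 : 1 < Module.finrank ℂ (LinearMap.ker (evalMap 2 4 B)) := by omega
  have h5 : Nontrivial (LinearMap.ker (evalMap 2 4 B)) :=
    Module.nontrivial_of_finrank_pos (R := ℂ) (by omega)
  obtain ⟨x, hx⟩ := exists_ne (0 : LinearMap.ker (evalMap 2 4 B))
  have h6 : ¬ ∀ w : LinearMap.ker (evalMap 2 4 B), ∃ c : ℂ, c • x = w := by
    intro h
    have := finrank_le_one x h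
    omega
  push Not at h6
  obtain ⟨y, hy⟩ := h6
  refine ⟨x.1.1, y.1.1, x.1.2, y.1.2, ?_, ?_, ?_, ?_⟩
  · intro h
    exact hx (Subtype.ext (Subtype.ext h))
  · intro c h
    apply hy c
    apply Subtype.ext
    apply Subtype.ext
    rw [h, ← smul_eq_C_mul]
    rfl
  · intro P hP
    exact congrFun (LinearMap.mem_ker.1 x.2) ⟨P, hP⟩
  · intro P hP
    exact congrFun (LinearMap.mem_ker.1 y.2) ⟨P, hP⟩

theorem key {A B : Finset (Proj 2)} (a b : Proj 2 → ℂ) (hA : A.card = 13) (hB : B.card = 13)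
    (hAB : A ≠ B) (ha : ∀ P ∈ A, a P ≠ 0)
    (hrel : ∀ F : MvPolynomial (Fin 3) ℂ, F.IsHomogeneous 8 →
      ∑ P ∈ A, a P * eval P.rep F = ∑ P ∈ B, b P * eval P.rep F)
    (h4 : Indep A 4) (h3 : ∀ W ⊆ A, W.card ≤ 10 → Indep W 3) : False := by
  classical
  obtain ⟨G1, G2, g1, g2, g0, gne, gB1, gB2⟩ := two_quartics hB
  have delta : ∀ P ∈ A, ∃ F : MvPolynomial (Fin 3) ℂ, F.IsHomogeneous 4 ∧ eval P.rep F = 1 ∧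
      ∀ Q ∈ A, Q ≠ P → eval Q.rep F = 0 := by
    intro P hP
    obtain ⟨F, f1, f2⟩ := h4 (fun Q => if Q = P then 1 else 0)
    refine ⟨F, f1, by rw [f2 P hP]; simp, fun Q hQ hne => by rw [f2 Q hQ]; simp [hne]⟩
  have trans : ∀ G : MvPolynomial (Fin 3) ℂ, G.IsHomogeneous 4 → (∀ P ∈ B, eval P.rep G = 0) →
      ∀ P ∈ A, eval P.rep G = 0 := by
    intro G hG hGB P hP
    obtain ⟨F, f1, f2, f3⟩ := delta P hP
    have h := hrel (G * F) (hG.mul f1)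
    rw [Finset.sum_eq_single P, Finset.sum_eq_zero, map_mul, f2, mul_one] at h
    · exact (mul_eq_zero.1 h).resolve_left (ha P hP)
    · intro Q hQ
      rw [map_mul, hGB Q hQ]; ring
    · intro Q hQ hne
      rw [map_mul, f3 Q hQ hne]; ring
    · exact fun h => absurd hP h
  have gA1 := trans G1 g1 gB1
  have gA2 := trans G2 g2 gB2
  have g20 : G2 ≠ 0 := by
    intro h
    apply gne 0
    simp [h]
  obtain ⟨H1, H2, D, hr, e1, e2⟩ := UniqueFactorizationMonoid.exists_reduced_factors G1 g0 G2
  have D0 : D ≠ 0 := by rintro rfl; exact g0 (by rw [← e1, zero_mul])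
  have H10 : H1 ≠ 0 := by rintro rfl; exact g0 (by rw [← e1, mul_zero])
  have H20 : H2 ≠ 0 := by rintro rfl; exact g20 (by rw [← e2, mul_zero])
  obtain ⟨e, f, hef, hD, hH1⟩ := hom_factor (e1.symm ▸ g1) D0 H10
  obtain ⟨e2d, f2d, hef', hD', hH2⟩ := hom_factor (e2.symm ▸ g2) D0 H20
  have : e2d = e := hD'.inj_right hD D0
  subst this
  have : f2d = f := by omega
  subst this
  have hf0 : f2d ≠ 0 := by
    rintro rfl
    have c1 := (totalDegree_zero_iff_isHomogeneous _).2 hH1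
    have c2 := (totalDegree_zero_iff_isHomogeneous _).2 hH2
    rw [totalDegree_eq_zero_iff_eq_C] at c1 c2
    have hc : coeff 0 H1 ≠ 0 := by
      intro h
      rw [h] at c1
      exact H10 (by rw [c1]; simp)
    apply gne (coeff 0 H2 / coeff 0 H1)
    rw [← e1, ← e2, c1, c2]
    simp only [coeff_C, if_true]
    rw [mul_left_comm, ← C_mul, div_mul_cancel₀ _ hc]
  have offD : ∀ P : Proj 2, eval P.rep G1 = 0 → eval P.rep G2 = 0 → eval P.rep D ≠ 0 →
      eval P.rep H1 = 0 ∧ eval P.rep H2 = 0 := by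
    intro P p1 p2 p3
    rw [← e1, map_mul] at p1
    rw [← e2, map_mul] at p2
    exact ⟨(mul_eq_zero.1 p1).resolve_left p3, (mul_eq_zero.1 p2).resolve_left p3⟩
  by_cases he0 : e2d = 0
  · subst he0
    have hf : f2d = 4 := by omega
    subst hf
    have Dne : ∀ P : Proj 2, eval P.rep D ≠ 0 := by
      intro P h
      have c1 := (totalDegree_zero_iff_isHomogeneous _).2 hD
      rw [totalDegree_eq_zero_iff_eq_C] at c1
      rw [c1, eval_C] at h
      rw [h] at c1
      exact D0 (by rw [c1]; simp)
    have hZ : ∀ P ∈ A ∪ B, eval P.rep H1 = 0 ∧ eval P.rep H2 = 0 := by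
      intro P hP
      rcases Finset.mem_union.1 hP with h | h
      · exact offD P (gA1 P h) (gA2 P h) (Dne P)
      · exact offD P (gB1 P h) (gB2 P h) (Dne P)
    have hcard : (A ∪ B).card ≤ 16 := by
      by_contra hc
      push Not at hc
      obtain ⟨W, w1, w2⟩ := Finset.exists_subset_card_eq (show 17 ≤ (A ∪ B).card by omega)
      have := koszul_bound 12 hH1 hH2 H20 hr (W := W) (fun P hP => (hZ P (w1 hP)).1)
        (fun P hP => (hZ P (w1 hP)).2) (indep_of_card (by omega))
      rw [w2] at this
      norm_num [Nat.choose] at this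
    have hdiff : (B \ A).card ≤ 4 := by
      have := Finset.card_sdiff_add_card B A
      rw [Finset.union_comm] at this
      omega
    obtain ⟨P, hPA, hPB⟩ : ∃ P ∈ A, P ∉ B := by
      by_contra h
      push Not at h
      exact hAB (Finset.eq_of_subset_of_card_le h (by omega))
    obtain ⟨F, f1, f2, f3⟩ := delta P hPA
    obtain ⟨L, l1, l2, l3⟩ := sep (B \ A) P 4 (by simp [hPB]) hdiff
    have h := hrel (F * L) (f1.mul l1)
    rw [Finset.sum_eq_single P, Finset.sum_eq_zero, map_mul, f2, one_mul] at h
    · exact mul_ne_zero (ha P hPA) l3 h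
    · intro Q hQ
      rw [map_mul]
      by_cases hQA : Q ∈ A
      · rw [f3 Q hQA (by rintro rfl; exact hPB hQ)]; ring
      · rw [l2 Q (by simp [hQ, hQA])]; ring
    · intro Q hQ hne
      rw [map_mul, f3 Q hQ hne]; ring
    · exact fun h => absurd hPA h
  · have hsplit := Finset.card_filter_add_card_filter_not (s := A) (fun P => eval P.rep D = 0)
    rw [hA] at hsplit
    have hW1 : ∀ k b, e2d + k = 3 → 10 ≤ (k + 2).choose 2 + b → b < 10 →
        (A.filter (fun P => eval P.rep D = 0)).card ≤ b := by
      intro k b hk hb hb'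
      apply card_bound b hb'
      intro W' w1 w2
      have hi := h3 W' (w1.trans (Finset.filter_subset _ _)) w2
      rw [← hk] at hi
      have := curve_bound k hD D0 (fun P hP => (Finset.mem_filter.1 (w1 hP)).2) hi
      rw [hk] at this
      have h10 : (3 + 2).choose 2 = 10 := by decide
      omega
    have hW2 : ∀ k b, f2d + k = 3 → 10 + (k + 2 - f2d).choose 2 ≤ 2 * (k + 2).choose 2 + b → b < 10 →
        (A.filter (fun P => ¬ eval P.rep D = 0)).card ≤ b := by
      intro k b hk hb hb'
      apply card_bound b hb'
      intro W' w1 w2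
      have hi := h3 W' (w1.trans (Finset.filter_subset _ _)) w2
      rw [← hk] at hi
      have hz : ∀ P ∈ W', eval P.rep H1 = 0 ∧ eval P.rep H2 = 0 := by
        intro P hP
        obtain ⟨q1, q2⟩ := Finset.mem_filter.1 (w1 hP)
        exact offD P (gA1 P q1) (gA2 P q1) q2
      have := koszul_bound k hH1 hH2 H20 hr (fun P hP => (hz P hP).1) (fun P hP => (hz P hP).2) hi
      rw [hk] at this
      have h10 : (3 + 2).choose 2 = 10 := by decide
      omega
    have hcases : (e2d = 1 ∧ f2d = 3) ∨ (e2d = 2 ∧ f2d = 2) ∨ (e2d = 3 ∧ f2d = 1) := by omega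
    rcases hcases with ⟨rfl, rfl⟩ | ⟨rfl, rfl⟩ | ⟨rfl, rfl⟩
    · have q1 := hW1 2 4 rfl (by decide) (by decide)
      have q2 := hW2 0 8 rfl (by decide) (by decide)
      omega
    · have q1 := hW1 1 7 rfl (by decide) (by decide)
      have q2 := hW2 1 4 rfl (by decide) (by decide)
      omega
    · have q1 := hW1 0 9 rfl (by decide) (by decide)
      have q2 := hW2 2 1 rfl (by decide) (by decide)
      omega

theorem coeffs {A : Finset (Proj 2)} {d : ℕ} {T : MvPolynomial (Fin 3) ℂ}
    (hA : NRComputes 2 d A T) :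
    ∃ a : Proj 2 → ℂ, (∀ P ∈ A, a P ≠ 0) ∧ T = ∑ P ∈ A, a P • vero 2 d P := by
  classical
  obtain ⟨h1, h2⟩ := hA
  obtain ⟨a, ha⟩ := Submodule.mem_span_image_finset_iff_exists_fun' ℂ |>.1 h1
  refine ⟨a, ?_, ha.symm⟩
  intro P hP h0
  apply h2 (A.erase P) (Finset.erase_ssubset hP)
  refine (Submodule.mem_span_image_finset_iff_exists_fun' ℂ).2 ⟨a, ?_⟩
  rw [← ha, ← Finset.add_sum_erase A _ hP, h0]
  simp

theorem kruskal {A : Finset (Proj 2)} (hk : kruskalRank 2 3 A = 10) :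
    ∀ W ⊆ A, W.card ≤ 10 → Indep W 3 := by
  have hm := Nat.sSup_mem (s := {k | k ≤ A.card ∧
    ∀ A' ⊆ A, A'.card ≤ k → LinearIndependent ℂ (fun P : A' => vero 2 3 P.1)})
    ⟨0, Nat.zero_le _, by
      intro A' _ h
      have : A' = ∅ := Finset.card_eq_zero.1 (by omega)
      subst this
      exact linearIndependent_empty_type⟩ ⟨A.card, fun k hk => hk.1⟩
  change kruskalRank 2 3 A ∈ _ at hm
  rw [hk] at hm
  intro W hW hc
  exact indep_of_li (hm.2 W hW hc)

end S9

/-- Claim: for degree `8` ternary forms with a non-redundant decomposition `A` of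
length `14` with `k₃(A) = 10` and `h_A(4) = 14`, any second non-redundant decomposition
`B` of length `14` yields `Z = A ∪ B` satisfying `CB(8)`. -/
theorem stmt9
    (T : MvPolynomial (Fin 3) ℂ) (hT0 : T ≠ 0) (hTh : T.IsHomogeneous 8)
    (A : Finset (Proj 2)) (hA : NRComputes 2 8 A T) (hAc : A.card = 14)
    (hk : kruskalRank 2 3 A = 10) (hh : hilbN 2 A 4 = 14)
    (B : Finset (Proj 2)) (hB : NRComputes 2 8 B T) (hBc : B.card = 14) (hBA : B ≠ A) :
    CB 2 8 (A ∪ B) := by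
  obtain ⟨a, ha, hTa⟩ := S9.coeffs hA
  obtain ⟨b, hb, hTb⟩ := S9.coeffs hB
  have hrel : ∀ F : MvPolynomial (Fin 3) ℂ, F.IsHomogeneous 8 →
      ∑ P ∈ A, a P * eval P.rep F = ∑ P ∈ B, b P * eval P.rep F := by
    intro F hF
    obtain ⟨ψ, hψ⟩ := S9.exists_dual hF
    have h1 := congrArg ψ (hTa.symm.trans hTb)
    simp only [map_sum, map_smul, hψ, smul_eq_mul] at h1
    exact h1
  intro P hP F hF hv
  have h := hrel F hF
  have vA : ∀ Q ∈ A, Q ≠ P → a Q * eval Q.rep F = 0 := fun Q hQ hne => by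
    rw [hv Q (Finset.mem_union_left _ hQ) hne, mul_zero]
  have vB : ∀ Q ∈ B, Q ≠ P → b Q * eval Q.rep F = 0 := fun Q hQ hne => by
    rw [hv Q (Finset.mem_union_right _ hQ) hne, mul_zero]
  by_cases hPA : P ∈ A
  · rw [Finset.sum_eq_single P vA (fun h => absurd hPA h)] at h
    by_cases hPB : P ∈ B
    · rw [Finset.sum_eq_single P vB (fun h => absurd hPB h)] at h
      by_cases hab : a P = b P
      · exfalso
        refine S9.key (A := A.erase P) (B := B.erase P) a b ?_ ?_ ?_ ?_ ?_ ?_ ?_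
        · rw [Finset.card_erase_of_mem hPA, hAc]
        · rw [Finset.card_erase_of_mem hPB, hBc]
        · intro he
          apply hBA
          rw [← Finset.insert_erase hPA, ← Finset.insert_erase hPB, he]
        · exact fun Q hQ => ha Q (Finset.mem_of_mem_erase hQ)
        · intro G hG
          have hg := hrel G hG
          rw [← Finset.add_sum_erase A _ hPA, ← Finset.add_sum_erase B _ hPB, hab] at hg
          exact add_left_cancel hg
        · exact (S9.indep_of_hilb (hh.trans hAc.symm)).mono (Finset.erase_subset _ _)
        · exact fun W hW => S9.kruskal hk W (hW.trans (Finset.erase_subset _ _))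
      · have : (a P - b P) * eval P.rep F = 0 := by rw [sub_mul, h, sub_self]
        exact (mul_eq_zero.1 this).resolve_left (sub_ne_zero.2 hab)
    · rw [Finset.sum_eq_zero (fun Q hQ => vB Q hQ (by rintro rfl; exact hPB hQ))] at h
      exact (mul_eq_zero.1 h).resolve_left (ha P hPA)
  · have hPB : P ∈ B := (Finset.mem_union.1 hP).resolve_left hPA
    rw [Finset.sum_eq_single P vB (fun h => absurd hPB h),
      Finset.sum_eq_zero (fun Q hQ => vA Q hQ (by rintro rfl; exact hPA hQ))] at h
    exact (mul_eq_zero.1 h.symm).resolve_left (hb P hPB)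
end

section
/- Let T ∈ S⁸ ℂ³ be a nonzero ternary form of degree 8 and let A ⊆ ℙ²(ℂ) be a non-redundant finite set computing T with ℓ(A) = 14, k₃(A) = 10, and h_A(4) = 14. Let B ⊆ ℙ²(ℂ) be another non-redundant finite set computing T with ℓ(B) = 14 and B ≠ A, and set Z = A ∪ B. Then A ∩ B = ∅, ℓ(Z) = 28, and the first difference of the Hilbert function of Z satisfies Dh_Z(0),…,Dh_Z(9) = 1, 2, 3, 4, 4, 4, 4, 3, 2, 1 and Dh_Z(j) = 0 for all j ≥ 10. -/
open MvPolynomial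

/-! ### Basic facts on homogeneous polynomials -/

noncomputable section helpers

/-- Degree `d` ternary forms. -/
abbrev Sd (d : ℕ) := MvPolynomial.homogeneousSubmodule (Fin 3) ℂ d

instance Sd_finite (d : ℕ) : Module.Finite ℂ (Sd d) :=
  Module.Finite.of_fg (MvPolynomial.homogeneousSubmodule_fg (Fin 3) ℂ d)

instance Sd_finite' (d : ℕ) :
    Module.Finite ℂ (MvPolynomial.homogeneousSubmodule (Fin (2 + 1)) ℂ d) := Sd_finite d

theorem finrank_Sd (d : ℕ) : Module.finrank ℂ (Sd d) = (d + 2).choose 2 := by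
  have e1 : (Sd d : Submodule ℂ (MvPolynomial (Fin 3) ℂ))
      = AddMonoidAlgebra.supported ℂ ℂ {s : Fin 3 →₀ ℕ | s.degree = d} :=
    MvPolynomial.homogeneousSubmodule_eq_finsupp_supported (Fin 3) ℂ d
  have hset : {s : Fin 3 →₀ ℕ | s.degree = d}
      = ((Finset.univ : Finset (Fin 3)).finsuppAntidiag d : Set (Fin 3 →₀ ℕ)) := by
    ext s
    simp [Finset.mem_finsuppAntidiag, Finsupp.degree_eq_sum]
  have e2 : Module.finrank ℂ (Sd d) = Module.finrank ℂ
      (AddMonoidAlgebra.supported ℂ ℂ {s : Fin 3 →₀ ℕ | s.degree = d}) := by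
    rw [← e1]
  rw [e2, (AddMonoidAlgebra.supportedEquivFinsupp (R := ℂ) (S := ℂ)
    {s : Fin 3 →₀ ℕ | s.degree = d}).finrank_eq, hset]
  rw [Module.finrank_finsupp_self]
  simp only [Finset.coe_sort_coe, Fintype.card_coe]
  rw [Finset.card_finsuppAntidiag_nat_eq_choose]
  simp only [Finset.card_univ, Fintype.card_fin]
  rw [show 3 + d - 1 = d + 2 by omega, ← Nat.choose_symm (by omega : d ≤ d + 2)]
  congr 1
  omega

/-- The homogenizing map `f ↦ f(tX)`. -/
def tmap : MvPolynomial (Fin 3) ℂ →ₐ[ℂ] Polynomial (MvPolynomial (Fin 3) ℂ) :=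
  MvPolynomial.aeval (fun i => Polynomial.C (MvPolynomial.X i) * Polynomial.X)

theorem tmap_monomial (s : Fin 3 →₀ ℕ) (r : ℂ) :
    tmap (MvPolynomial.monomial s r)
      = Polynomial.C (MvPolynomial.monomial s r) * Polynomial.X ^ s.degree := by
  rw [tmap, MvPolynomial.aeval_monomial, MvPolynomial.monomial_eq]
  simp only [mul_pow, map_mul, Finsupp.prod, map_prod, map_pow,
    Finset.prod_pow_eq_pow_sum, Finsupp.degree, Finset.prod_mul_distrib]
  rw [mul_assoc]
  rfl

theorem tmap_coeff (f : MvPolynomial (Fin 3) ℂ) (k : ℕ) :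
    (tmap f).coeff k = MvPolynomial.homogeneousComponent k f := by
  induction f using MvPolynomial.induction_on' with
  | monomial b a =>
    rw [tmap_monomial, Polynomial.coeff_C_mul_X_pow]
    rw [MvPolynomial.homogeneousComponent_of_mem (MvPolynomial.isHomogeneous_monomial a rfl)]
  | add p q hp hq =>
    rw [map_add, Polynomial.coeff_add, hp, hq, map_add]

theorem homog_of_mul {f g : MvPolynomial (Fin 3) ℂ} {n : ℕ} (h : (f * g).IsHomogeneous n)
    (hfg : f * g ≠ 0) : ∃ k, f.IsHomogeneous k := by
  have hf : f ≠ 0 := left_ne_zero_of_mul hfg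
  have hg : g ≠ 0 := right_ne_zero_of_mul hfg
  have hsum : ∀ p : MvPolynomial (Fin 3) ℂ, tmap p = 0 → p = 0 := by
    intro p hp
    rw [← MvPolynomial.sum_homogeneousComponent p]
    apply Finset.sum_eq_zero
    intro i _
    rw [← tmap_coeff, hp, Polynomial.coeff_zero]
  have h1 : tmap f ≠ 0 := fun h => hf (hsum _ h)
  have h2 : tmap g ≠ 0 := fun h => hg (hsum _ h)
  have h3 : tmap f * tmap g = Polynomial.C (f * g) * Polynomial.X ^ n := by
    rw [← map_mul]
    ext1 k
    rw [tmap_coeff, Polynomial.coeff_C_mul_X_pow, MvPolynomial.homogeneousComponent_of_mem h]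
  have h4 := Polynomial.natDegree_mul h1 h2
  have h5 := Polynomial.natTrailingDegree_mul h1 h2
  rw [h3, Polynomial.natDegree_C_mul_X_pow n _ hfg] at h4
  rw [h3, Polynomial.C_mul_X_pow_eq_monomial, Polynomial.natTrailingDegree_monomial hfg] at h5
  have h6 := Polynomial.natTrailingDegree_le_natDegree (tmap f)
  have h7 := Polynomial.natTrailingDegree_le_natDegree (tmap g)
  have h8 : (tmap f).natTrailingDegree = (tmap f).natDegree := by omega
  refine ⟨(tmap f).natDegree, ?_⟩
  have : f = MvPolynomial.homogeneousComponent (tmap f).natDegree f := by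
    conv_lhs => rw [← MvPolynomial.sum_homogeneousComponent f]
    rw [Finset.sum_eq_single (tmap f).natDegree]
    · intro b _ hb
      rw [← tmap_coeff]
      rcases lt_or_gt_of_ne hb with h | h
      · exact Polynomial.coeff_eq_zero_of_lt_natTrailingDegree (h8 ▸ h)
      · exact Polynomial.coeff_eq_zero_of_natDegree_lt h
    · intro hn
      apply MvPolynomial.homogeneousComponent_eq_zero
      simpa using hn
  have hc := MvPolynomial.homogeneousComponent_isHomogeneous (tmap f).natDegree f
  rwa [← this] at hc

theorem homog_quot {f g : MvPolynomial (Fin 3) ℂ} {m n : ℕ} (hf : f.IsHomogeneous m) (hf0 : f ≠ 0)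
    (h : (f * g).IsHomogeneous (m + n)) : g.IsHomogeneous n := by
  by_cases hg : g = 0
  · rw [hg]; exact MvPolynomial.isHomogeneous_zero _ _ _
  · have h0 : f * g ≠ 0 := mul_ne_zero hf0 hg
    obtain ⟨k, hk⟩ := homog_of_mul (f := g) (g := f) (by rwa [mul_comm]) (by rwa [mul_comm])
    have := (hf.mul hk).inj_right h h0
    have : k = n := by omega
    rwa [← this]

/-! ### Ideals, relations, Hilbert functions -/

/-- Forms of degree `d` vanishing on `Z`. -/
abbrev IdZ (d : ℕ) (Z : Finset (Proj 2)) : Submodule ℂ (Sd d) := LinearMap.ker (evalMap 2 d Z)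

theorem mem_Id {d : ℕ} {Z : Finset (Proj 2)} {F : Sd d} :
    F ∈ IdZ d Z ↔ ∀ P ∈ Z, MvPolynomial.eval P.rep F.1 = 0 := by
  rw [LinearMap.mem_ker]
  constructor
  · intro h P hP
    exact congrFun h ⟨P, hP⟩
  · intro h
    funext P
    exact h P.1 P.2

theorem finrank_Id (d : ℕ) (Z : Finset (Proj 2)) :
    hilbN 2 Z d + Module.finrank ℂ (IdZ d Z) = (d + 2).choose 2 := by
  rw [← finrank_Sd d]
  exact LinearMap.finrank_range_add_finrank_ker (evalMap 2 d Z)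

/-- Pairing of coefficient vectors with forms. -/
def pairing (d : ℕ) (Z : Finset (Proj 2)) : (Z → ℂ) →ₗ[ℂ] Module.Dual ℂ (Sd d) :=
  (evalMap 2 d Z).dualMap ∘ₗ (Module.piEquiv Z ℂ ℂ).toLinearMap

theorem pairing_apply (d : ℕ) (Z : Finset (Proj 2)) (c : Z → ℂ) (F : Sd d) :
    pairing d Z c F = ∑ P : Z, c P * MvPolynomial.eval P.1.rep F.1 := by
  simp only [pairing, LinearMap.comp_apply, LinearMap.dualMap_apply, LinearEquiv.coe_coe,
    Module.piEquiv_apply_apply, smul_eq_mul]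
  apply Finset.sum_congr rfl
  intro P _
  rw [mul_comm]
  rfl

/-- Linear relations among the evaluations at `Z` in degree `d`. -/
abbrev RelZ (d : ℕ) (Z : Finset (Proj 2)) : Submodule ℂ (Z → ℂ) := LinearMap.ker (pairing d Z)

theorem mem_Rel {d : ℕ} {Z : Finset (Proj 2)} {c : Z → ℂ} :
    c ∈ RelZ d Z ↔ ∀ F : MvPolynomial (Fin 3) ℂ, F.IsHomogeneous d →
      ∑ P : Z, c P * MvPolynomial.eval P.1.rep F = 0 := by
  rw [LinearMap.mem_ker]
  constructor
  · intro h F hF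
    have := congrArg (fun φ => φ (⟨F, hF⟩ : Sd d)) h
    simpa [pairing_apply] using this
  · intro h
    ext F
    rw [pairing_apply]
    exact h F.1 F.2

theorem finrank_Rel (d : ℕ) (Z : Finset (Proj 2)) :
    hilbN 2 Z d + Module.finrank ℂ (RelZ d Z) = Z.card := by
  have h := LinearMap.finrank_range_add_finrank_ker (pairing d Z)
  have h2 : LinearMap.range (pairing d Z) = LinearMap.range (evalMap 2 d Z).dualMap := by
    rw [pairing, LinearMap.range_comp, LinearEquiv.range, Submodule.map_top]
  rw [h2, LinearMap.finrank_range_dualMap_eq_finrank_range] at h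
  simpa [hilbN] using h

/-- `Z` imposes independent conditions in degree `d`. -/
def Ind (d : ℕ) (Z : Finset (Proj 2)) : Prop := Function.Surjective (evalMap 2 d Z)

theorem ind_iff {d : ℕ} {Z : Finset (Proj 2)} : Ind d Z ↔ hilbN 2 Z d = Z.card := by
  rw [Ind, ← LinearMap.range_eq_top, hilbN]
  constructor
  · intro h; rw [h]; simp
  · intro h
    apply Submodule.eq_top_of_finrank_eq
    rw [h]; simp

theorem Ind.mono {d : ℕ} {Y Z : Finset (Proj 2)} (h : Ind d Z) (hYZ : Y ⊆ Z) : Ind d Y := by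
  intro g
  obtain ⟨F, hF⟩ := h (fun P => if hP : P.1 ∈ Y then g ⟨P.1, hP⟩ else 0)
  refine ⟨F, ?_⟩
  funext P
  have := congrFun hF ⟨P.1, hYZ P.2⟩
  simp only [P.2, dif_pos] at this
  exact this

theorem Ind.exists_form {d : ℕ} {Z : Finset (Proj 2)} (h : Ind d Z) {P : Proj 2} (hP : P ∈ Z) :
    ∃ F : MvPolynomial (Fin 3) ℂ, F.IsHomogeneous d ∧ MvPolynomial.eval P.rep F = 1 ∧
      ∀ Q ∈ Z, Q ≠ P → MvPolynomial.eval Q.rep F = 0 := by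
  obtain ⟨F, hF⟩ := h (fun Q => if Q.1 = P then 1 else 0)
  refine ⟨F.1, F.2, ?_, ?_⟩
  · have := congrFun hF ⟨P, hP⟩
    simp only [if_true] at this
    exact this
  · intro Q hQ hQP
    have := congrFun hF ⟨Q, hQ⟩
    simp only [hQP, if_false] at this
    exact this

theorem ind_of_forms {d : ℕ} {Z : Finset (Proj 2)}
    (h : ∀ P ∈ Z, ∃ F : MvPolynomial (Fin 3) ℂ, F.IsHomogeneous d ∧
      MvPolynomial.eval P.rep F ≠ 0 ∧
      ∀ Q ∈ Z, Q ≠ P → MvPolynomial.eval Q.rep F = 0) : Ind d Z := by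
  rw [ind_iff]
  have h0 := finrank_Rel d Z
  have : RelZ d Z = ⊥ := by
    rw [eq_bot_iff]
    intro c hc
    rw [Submodule.mem_bot]
    funext P
    obtain ⟨F, hF, h1, h2⟩ := h P.1 P.2
    have := mem_Rel.1 hc F hF
    rw [Finset.sum_eq_single P] at this
    · rcases mul_eq_zero.1 this with h | h
      · exact h
      · exact absurd h h1
    · intro Q _ hQ
      rw [h2 Q.1 Q.2 (fun h => hQ (Subtype.ext h)), mul_zero]
    · simp
  rw [this, finrank_bot] at h0
  omega

/-- Multiplying a relation by a form. -/
theorem mul_Rel {i j d : ℕ} {Z : Finset (Proj 2)} {c : Z → ℂ} (hc : c ∈ RelZ d Z)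
    {F : MvPolynomial (Fin 3) ℂ} (hF : F.IsHomogeneous i) (hd : i + j = d) :
    (fun P : Z => MvPolynomial.eval P.1.rep F * c P) ∈ RelZ j Z := by
  rw [mem_Rel]
  intro G hG
  have := mem_Rel.1 hc (F * G) (hd ▸ hF.mul hG)
  rw [← this]
  apply Finset.sum_congr rfl
  intro P _
  rw [map_mul]; ring

/-- Multiplication by a form as a linear map. -/
def mulMap {e : ℕ} (D : Sd e) (k d : ℕ) (h : e + k = d) : Sd k →ₗ[ℂ] Sd d where
  toFun F := ⟨D.1 * F.1, h ▸ D.2.mul F.2⟩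
  map_add' F G := by ext1; simp [mul_add]
  map_smul' a F := by ext1; simp

theorem mulMap_inj {e : ℕ} (D : Sd e) (hD : D.1 ≠ 0) (k d : ℕ) (h : e + k = d) :
    Function.Injective (mulMap D k d h) := by
  intro F G hFG
  have : D.1 * F.1 = D.1 * G.1 := congrArg Subtype.val hFG
  exact Subtype.ext (mul_left_cancel₀ hD this)

theorem hilb_le_of_curve {e k d : ℕ} (h : e + k = d) {D : MvPolynomial (Fin 3) ℂ}
    (hD : D.IsHomogeneous e) (hD0 : D ≠ 0) {Z : Finset (Proj 2)}
    (hZ : ∀ P ∈ Z, MvPolynomial.eval P.rep D = 0) :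
    hilbN 2 Z d + (k + 2).choose 2 ≤ (d + 2).choose 2 := by
  have h1 := finrank_Id d Z
  have h2 : LinearMap.range (mulMap ⟨D, hD⟩ k d h) ≤ IdZ d Z := by
    rintro _ ⟨F, rfl⟩
    rw [mem_Id]
    intro P hP
    simp [mulMap, hZ P hP]
  have h3 := Submodule.finrank_mono h2
  rw [LinearMap.finrank_range_of_inj (mulMap_inj ⟨D, hD⟩ hD0 k d h), finrank_Sd] at h3
  omega

/-- The Koszul-type map `(u, v) ↦ F u + G v`. -/
theorem hilb_le_of_curves {a b k d : ℕ} (h : a + (b + k) = d) {F G : MvPolynomial (Fin 3) ℂ}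
    (hF : F.IsHomogeneous a) (hG : G.IsHomogeneous b) (hG0 : G ≠ 0)
    (hrel : IsRelPrime F G) {Z : Finset (Proj 2)}
    (hZF : ∀ P ∈ Z, MvPolynomial.eval P.rep F = 0)
    (hZG : ∀ P ∈ Z, MvPolynomial.eval P.rep G = 0) :
    hilbN 2 Z d + (b + k + 2).choose 2 + (a + k + 2).choose 2
      ≤ (d + 2).choose 2 + (k + 2).choose 2 := by
  have h' : b + (a + k) = d := by omega
  have h1 := finrank_Id d Z
  let φ : (Sd (b + k) × Sd (a + k)) →ₗ[ℂ] Sd d :=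
    (mulMap ⟨F, hF⟩ (b + k) d h).coprod (mulMap ⟨G, hG⟩ (a + k) d h')
  have h2 : LinearMap.range φ ≤ IdZ d Z := by
    rintro _ ⟨⟨u, v⟩, rfl⟩
    rw [mem_Id]
    intro P hP
    simp [φ, mulMap, hZF P hP, hZG P hP]
  have h3 := Submodule.finrank_mono h2
  let ψ : Sd k →ₗ[ℂ] (Sd (b + k) × Sd (a + k)) :=
    (mulMap ⟨G, hG⟩ k (b + k) rfl).prod (-(mulMap ⟨F, hF⟩ k (a + k) rfl))
  have h4 : LinearMap.ker φ ≤ LinearMap.range ψ := by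
    rintro ⟨u, v⟩ huv
    rw [LinearMap.mem_ker] at huv
    have e1 : F * u.1 + G * v.1 = 0 := by
      have := congrArg Subtype.val huv
      simpa [φ, mulMap] using this
    have e2 : G ∣ F * u.1 := ⟨-v.1, by linear_combination e1⟩
    obtain ⟨w, hw⟩ := hrel.symm.dvd_of_dvd_mul_left e2
    have hwh : w.IsHomogeneous k := homog_quot hG hG0 (by rw [← hw]; exact u.2)
    refine ⟨⟨w, hwh⟩, ?_⟩
    apply Prod.ext
    · apply Subtype.ext
      simp [ψ, mulMap, hw]
    · apply Subtype.ext
      have e3 : G * (-(F * w)) = G * v.1 := by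
        rw [hw] at e1
        linear_combination -e1
      have := mul_left_cancel₀ hG0 e3
      simpa [ψ, mulMap] using this
  have h5 := Submodule.finrank_mono h4
  have h6 := LinearMap.finrank_range_le ψ
  have h7 := LinearMap.finrank_range_add_finrank_ker φ
  rw [Module.finrank_prod, finrank_Sd, finrank_Sd] at h7
  rw [finrank_Sd] at h6
  omega

theorem two_choose (n : ℕ) : 2 * (n + 2).choose 2 = (n + 2) * (n + 1) := by
  induction n with
  | zero => rfl
  | succ k ih =>
    rw [Nat.choose_succ_succ' (k + 2) 1, Nat.choose_one_right, mul_add, ih]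
    ring

/-! ### Separation of points and a weak form of Bezout -/

theorem exists_X_ne (P : Proj 2) : ∃ i : Fin 3, P.rep i ≠ 0 := by
  by_contra h
  push Not at h
  exact P.rep_nonzero (funext h)

theorem exists_line {P Q : Proj 2} (h : P ≠ Q) : ∃ L : MvPolynomial (Fin 3) ℂ,
    L.IsHomogeneous 1 ∧ MvPolynomial.eval Q.rep L = 0 ∧ MvPolynomial.eval P.rep L ≠ 0 := by
  by_contra hcon
  push Not at hcon
  have key : ∀ i j : Fin 3, Q.rep j * P.rep i = Q.rep i * P.rep j := by
    intro i j
    have := hcon (MvPolynomial.C (Q.rep j) * MvPolynomial.X i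
      - MvPolynomial.C (Q.rep i) * MvPolynomial.X j)
      ((MvPolynomial.isHomogeneous_C_mul_X _ _).sub (MvPolynomial.isHomogeneous_C_mul_X _ _))
      (by simp; ring)
    simp at this
    linear_combination this
  obtain ⟨j, hj⟩ := exists_X_ne Q
  apply h
  rw [← P.mk_rep, ← Q.mk_rep, Projectivization.mk_eq_mk_iff']
  refine ⟨P.rep j / Q.rep j, ?_⟩
  funext i
  simp only [Pi.smul_apply, smul_eq_mul]
  field_simp
  linear_combination -(key i j)

theorem ind_large {Z : Finset (Proj 2)} {d : ℕ} (hd : Z.card ≤ d) : Ind d Z := by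
  apply ind_of_forms
  intro P hP
  have hex : ∀ Q : Proj 2, ∃ L : MvPolynomial (Fin 3) ℂ, L.IsHomogeneous 1 ∧
      (Q ≠ P → MvPolynomial.eval Q.rep L = 0 ∧ MvPolynomial.eval P.rep L ≠ 0) := by
    intro Q
    by_cases h : P = Q
    · exact ⟨0, MvPolynomial.isHomogeneous_zero _ _ _, fun h' => absurd h.symm h'⟩
    · obtain ⟨L, h1, h2, h3⟩ := exists_line h
      exact ⟨L, h1, fun _ => ⟨h2, h3⟩⟩
  choose L hL hL2 using hex
  obtain ⟨i, hi⟩ := exists_X_ne P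
  have hc : (Z.erase P).card ≤ d := (Finset.card_erase_le).trans hd
  refine ⟨(∏ Q ∈ Z.erase P, L Q) * MvPolynomial.X i ^ (d - (Z.erase P).card), ?_, ?_, ?_⟩
  · have h1 := MvPolynomial.IsHomogeneous.prod (Z.erase P) L (fun _ => 1) (fun Q _ => hL Q)
    have h2 := h1.mul (MvPolynomial.isHomogeneous_X_pow (R := ℂ) i (d - (Z.erase P).card))
    convert h2 using 1
    simp only [Finset.sum_const, smul_eq_mul, mul_one]
    omega
  · rw [map_mul, map_prod, map_pow, MvPolynomial.eval_X]
    refine mul_ne_zero (Finset.prod_ne_zero_iff.2 ?_) (pow_ne_zero _ hi)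
    intro Q hQ
    exact (hL2 Q (Finset.ne_of_mem_erase hQ)).2
  · intro Q hQ hQP
    rw [map_mul, map_prod, Finset.prod_eq_zero (Finset.mem_erase.2 ⟨hQP, hQ⟩) (hL2 Q hQP).1,
      zero_mul]

theorem bezout {a b : ℕ} {F G : MvPolynomial (Fin 3) ℂ}
    (hF : F.IsHomogeneous a) (hG : G.IsHomogeneous b) (hG0 : G ≠ 0)
    (hrel : IsRelPrime F G) {Z : Finset (Proj 2)}
    (hZF : ∀ P ∈ Z, MvPolynomial.eval P.rep F = 0)
    (hZG : ∀ P ∈ Z, MvPolynomial.eval P.rep G = 0) : Z.card ≤ a * b := by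
  have h1 : Ind (a + (b + Z.card)) Z := ind_large (by omega)
  have h2 := hilb_le_of_curves (k := Z.card) rfl hF hG hG0 hrel hZF hZG
  rw [ind_iff.1 h1] at h2
  have e1 := two_choose (b + Z.card)
  have e2 := two_choose (a + Z.card)
  have e3 := two_choose (a + (b + Z.card))
  have e4 := two_choose Z.card
  nlinarith

/-! ### Powers of linear forms and relations -/

theorem rel_of_vero {d : ℕ} {Z : Finset (Proj 2)} {c : Proj 2 → ℂ}
    (h : ∑ P ∈ Z, c P • vero 2 d P = 0) {F : MvPolynomial (Fin 3) ℂ} (hF : F.IsHomogeneous d) :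
    ∑ P ∈ Z, c P * MvPolynomial.eval P.rep F = 0 := by
  have hco : ∀ s : Fin 3 →₀ ℕ, s.degree = d →
      ∑ P ∈ Z, c P * ∏ i, P.rep i ^ s i = 0 := by
    intro s hs
    have h1 := congrArg (MvPolynomial.coeff s) h
    rw [MvPolynomial.coeff_sum, MvPolynomial.coeff_zero] at h1
    have h2 : ∀ P : Proj 2, MvPolynomial.coeff s (vero 2 d P)
        = (s.multinomial : ℂ) * ∏ i, P.rep i ^ s i := by
      intro P
      have := MvPolynomial.coeff_linearCombination_X_pow_of_fintype (R := ℂ) P.rep s d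
      rw [if_pos (by rw [← hs]; rfl)] at this
      rw [Finsupp.prod_fintype _ _ (by simp)] at this
      rw [← this, vero, linForm]
      simp only [MvPolynomial.smul_eq_C_mul]
    simp only [MvPolynomial.coeff_smul, h2, smul_eq_mul] at h1
    have h3 : (s.multinomial : ℂ) ≠ 0 := by
      have : 0 < s.multinomial := Nat.multinomial_pos _ _
      exact_mod_cast this.ne'
    have h4 : (s.multinomial : ℂ) * ∑ P ∈ Z, c P * ∏ i, P.rep i ^ s i = 0 := by
      rw [← h1, Finset.mul_sum]
      apply Finset.sum_congr rfl
      intro P _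
      ring
    exact (mul_eq_zero.1 h4).resolve_left h3
  simp only [MvPolynomial.eval_eq', Finset.mul_sum]
  rw [Finset.sum_comm]
  apply Finset.sum_eq_zero
  intro s hs
  have hsd : s.degree = d := by
    by_contra hne
    exact (MvPolynomial.mem_support_iff.1 hs) (hF.coeff_eq_zero hne)
  have := hco s hsd
  calc _ = MvPolynomial.coeff s F * ∑ P ∈ Z, c P * ∏ i, P.rep i ^ s i := by
        rw [Finset.mul_sum]
        apply Finset.sum_congr rfl
        intro P _
        ring
    _ = 0 := by rw [this, mul_zero]

theorem eval_linForm_comm (x y : Fin 3 → ℂ) :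
    MvPolynomial.eval x (linForm 2 y) = MvPolynomial.eval y (linForm 2 x) := by
  simp only [linForm, map_sum, map_mul, MvPolynomial.eval_C, MvPolynomial.eval_X]
  apply Finset.sum_congr rfl
  intro i _
  ring

theorem linForm_homog (x : Fin 3 → ℂ) : (linForm 2 x).IsHomogeneous 1 :=
  MvPolynomial.IsHomogeneous.sum _ _ _ (fun _ _ => MvPolynomial.isHomogeneous_C_mul_X _ _)

theorem ind_of_linearIndependent {d : ℕ} {Z : Finset (Proj 2)}
    (h : LinearIndependent ℂ (fun P : Z => vero 2 d P.1)) : Ind d Z := by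
  rw [ind_iff]
  have h0 := finrank_Rel d Z
  have : RelZ d Z = ⊥ := by
    rw [eq_bot_iff]
    intro c hc
    rw [Submodule.mem_bot]
    funext P
    refine Fintype.linearIndependent_iff.1 h c ?_ P
    apply MvPolynomial.funext
    intro x
    have h1 := mem_Rel.1 hc (linForm 2 x ^ d) (by simpa using (linForm_homog x).pow d)
    rw [map_zero, map_sum, ← h1]
    apply Finset.sum_congr rfl
    intro Q _
    rw [MvPolynomial.smul_eval, vero, map_pow, map_pow, eval_linForm_comm]
  rw [this, finrank_bot] at h0
  omega

theorem kruskal_ind {A : Finset (Proj 2)} (hk : kruskalRank 2 3 A = 10) :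
    ∀ A' ⊆ A, A'.card ≤ 10 → Ind 3 A' := by
  have hmem := Nat.sSup_mem (s := {k | k ≤ A.card ∧
    ∀ A' ⊆ A, A'.card ≤ k → LinearIndependent ℂ (fun P : A' => vero 2 3 P.1)})
    ⟨0, Nat.zero_le _, by
      intro A' _ h
      have : A' = ∅ := Finset.card_eq_zero.1 (by omega)
      subst this
      exact linearIndependent_empty_type⟩
    ⟨A.card, fun k hk => hk.1⟩
  change kruskalRank 2 3 A ∈ _ at hmem
  rw [hk] at hmem
  intro A' h1 h2
  exact ind_of_linearIndependent (hmem.2 A' h1 h2)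

theorem curve_bound {A : Finset (Proj 2)} (hk : ∀ A' ⊆ A, A'.card ≤ 10 → Ind 3 A')
    {e k : ℕ} (h : e + k = 3) {D : MvPolynomial (Fin 3) ℂ} (hD : D.IsHomogeneous e) (hD0 : D ≠ 0)
    {Y : Finset (Proj 2)} (hY : Y ⊆ A) (hYD : ∀ P ∈ Y, MvPolynomial.eval P.rep D = 0) :
    Y.card + (k + 2).choose 2 ≤ 10 := by
  have main : ∀ Y' ⊆ Y, Y'.card ≤ 10 → Y'.card + (k + 2).choose 2 ≤ 10 := by
    intro Y' hY' hc
    have h1 := hilb_le_of_curve h hD hD0 (fun P hP => hYD P (hY' hP))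
    rw [ind_iff.1 (hk Y' (hY'.trans hY) hc)] at h1
    exact h1
  by_cases hc : Y.card ≤ 10
  · exact main Y (Finset.Subset.refl _) hc
  · obtain ⟨Y', h1, h2⟩ := Finset.exists_subset_card_eq (s := Y) (n := 10) (by omega)
    have h3 := main Y' h1 (by omega)
    have h4 : 0 < (k + 2).choose 2 := Nat.choose_pos (by omega)
    omega

theorem main_dvd {A B : Finset (Proj 2)} (hdis : Disjoint A B)
    (hk : ∀ A' ⊆ A, A'.card ≤ 10 → Ind 3 A') (hB : Ind 4 B) (hAB : A.card = B.card)
    {j : ℕ} (hj : 4 ≤ j) (hs : (A.card = 14 ∧ j ≤ 6) ∨ (11 ≤ A.card ∧ j = 4))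
    {Q F : MvPolynomial (Fin 3) ℂ} (hQ0 : Q ≠ 0) (hQ : Q.IsHomogeneous 4) (hF : F.IsHomogeneous j)
    (hQZ : ∀ P ∈ A ∪ B, MvPolynomial.eval P.rep Q = 0)
    (hFZ : ∀ P ∈ A ∪ B, MvPolynomial.eval P.rep F = 0) : Q ∣ F := by
  classical
  by_cases hF0 : F = 0
  · rw [hF0]; exact dvd_zero _
  obtain ⟨Q', F', D, hrel, rfl, rfl⟩ := UniqueFactorizationMonoid.exists_reduced_factors Q hQ0 F
  have hD0 : D ≠ 0 := left_ne_zero_of_mul hQ0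
  have hQ'0 : Q' ≠ 0 := right_ne_zero_of_mul hQ0
  have hF'0 : F' ≠ 0 := right_ne_zero_of_mul hF0
  obtain ⟨e, he⟩ := homog_of_mul hQ hQ0
  obtain ⟨k, hk'⟩ := homog_of_mul (f := Q') (g := D) (by rwa [mul_comm]) (by rwa [mul_comm])
  obtain ⟨l, hl⟩ := homog_of_mul (f := F') (g := D) (by rwa [mul_comm]) (by rwa [mul_comm])
  have hek : e + k = 4 := (he.mul hk').inj_right hQ hQ0
  have hel : e + l = j := (he.mul hl).inj_right hF hF0
  by_cases hk0 : k = 0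
  · subst hk0
    have hu : IsUnit Q' := by
      have h0 := (MvPolynomial.totalDegree_zero_iff_isHomogeneous _).2 hk'
      rw [MvPolynomial.totalDegree_eq_zero_iff_eq_C] at h0
      rw [h0]
      apply IsUnit.map
      rw [isUnit_iff_ne_zero]
      intro h
      rw [h, map_zero] at h0
      exact hQ'0 h0
    exact mul_dvd_mul_left D (hu.dvd)
  exfalso
  have hAD := curve_bound hk (show e + (3 - e) = 3 by omega) he hD0
    (Finset.filter_subset (fun P : Proj 2 => MvPolynomial.eval P.rep D = 0) A)
    (fun P hP => (Finset.mem_filter.1 hP).2)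
  have hBD := hilb_le_of_curve (show e + (4 - e) = 4 by omega) he hD0
    (Z := B.filter (fun P : Proj 2 => MvPolynomial.eval P.rep D = 0))
    (fun P hP => (Finset.mem_filter.1 hP).2)
  rw [ind_iff.1 (hB.mono (Finset.filter_subset _ _))] at hBD
  have hW := bezout hk' hl hF'0 hrel
    (Z := (A ∪ B).filter (fun P : Proj 2 => ¬ MvPolynomial.eval P.rep D = 0))
    (fun P hP => by
      obtain ⟨h1, h2⟩ := Finset.mem_filter.1 hP
      have := hQZ P h1
      rw [map_mul] at this
      exact (mul_eq_zero.1 this).resolve_left h2)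
    (fun P hP => by
      obtain ⟨h1, h2⟩ := Finset.mem_filter.1 hP
      have := hFZ P h1
      rw [map_mul] at this
      exact (mul_eq_zero.1 this).resolve_left h2)
  rw [Finset.filter_union, Finset.card_union_of_disjoint
    (Finset.disjoint_filter_filter hdis)] at hW
  have cA := Finset.card_filter_add_card_filter_not (s := A)
    (fun P : Proj 2 => MvPolynomial.eval P.rep D = 0)
  have cB := Finset.card_filter_add_card_filter_not (s := B)
    (fun P : Proj 2 => MvPolynomial.eval P.rep D = 0)
  have he3 : e ≤ 3 := by omega
  obtain rfl : k = 4 - e := by omega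
  obtain rfl : l = j - e := by omega
  have c3 := two_choose (3 - e)
  have c4 := two_choose (4 - e)
  have c5 : (4 + 2).choose 2 = 15 := by decide
  rw [c5] at hBD
  interval_cases e <;> omega

theorem finrank_of_dvd {Z : Finset (Proj 2)} {j k : ℕ} (hj : 4 + k = j)
    {Q : MvPolynomial (Fin 3) ℂ} (hQ0 : Q ≠ 0) (hQ : Q.IsHomogeneous 4)
    (hQZ : ∀ P ∈ Z, MvPolynomial.eval P.rep Q = 0)
    (h : ∀ F : MvPolynomial (Fin 3) ℂ, F.IsHomogeneous j →
      (∀ P ∈ Z, MvPolynomial.eval P.rep F = 0) → Q ∣ F) :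
    Module.finrank ℂ (IdZ j Z) = (k + 2).choose 2 := by
  have h1 : IdZ j Z = LinearMap.range (mulMap ⟨Q, hQ⟩ k j hj) := by
    apply le_antisymm
    · intro F hF
      obtain ⟨G, hG⟩ := h F.1 F.2 (mem_Id.1 hF)
      refine ⟨⟨G, homog_quot hQ hQ0 (by rw [← hG, hj]; exact F.2)⟩, ?_⟩
      apply Subtype.ext
      exact hG.symm
    · rintro _ ⟨F, rfl⟩
      rw [mem_Id]
      intro P hP
      simp [mulMap, hQZ P hP]
  rw [h1, LinearMap.finrank_range_of_inj (mulMap_inj ⟨Q, hQ⟩ hQ0 k j hj), finrank_Sd]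

theorem pairing_vanish {A B : Finset (Proj 2)} {c : Proj 2 → ℂ}
    (hcA : ∀ P ∈ A, c P ≠ 0)
    (hrel : ∀ F : MvPolynomial (Fin 3) ℂ, F.IsHomogeneous 8 →
      ∑ P ∈ A ∪ B, c P * MvPolynomial.eval P.rep F = 0) (hA : Ind 4 A)
    {F : MvPolynomial (Fin 3) ℂ} (hF : F.IsHomogeneous 4)
    (hFB : ∀ P ∈ B, MvPolynomial.eval P.rep F = 0) :
    ∀ P ∈ A, MvPolynomial.eval P.rep F = 0 := by
  intro P hP
  obtain ⟨G, hG, hG1, hG2⟩ := hA.exists_form hP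
  have h := hrel (F * G) (hF.mul hG)
  rw [Finset.sum_eq_single P] at h
  · rw [map_mul, hG1, mul_one] at h
    exact (mul_eq_zero.1 h).resolve_left (hcA P hP)
  · intro R hR hRP
    rw [map_mul]
    rcases Finset.mem_union.1 hR with h' | h'
    · rw [hG2 R h' hRP]; simp
    · rw [hFB R h']; simp
  · intro hn
    exact absurd (Finset.mem_union_left _ hP) hn

theorem pairing_main {A B : Finset (Proj 2)} {c : Proj 2 → ℂ}
    (hcA : ∀ P ∈ A, c P ≠ 0)
    (hrel : ∀ F : MvPolynomial (Fin 3) ℂ, F.IsHomogeneous 8 →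
      ∑ P ∈ A ∪ B, c P * MvPolynomial.eval P.rep F = 0) (hA : Ind 4 A)
    (hBA : B.card ≤ A.card) :
    A.card = B.card ∧ Ind 4 B ∧ IdZ 4 A = IdZ 4 B := by
  have hle : IdZ 4 B ≤ IdZ 4 A := by
    intro F hF
    rw [mem_Id] at hF ⊢
    exact pairing_vanish hcA hrel hA F.2 hF
  have h1 := Submodule.finrank_mono hle
  have h2 := finrank_Id 4 A
  have h3 := finrank_Id 4 B
  have h4 := finrank_Rel 4 B
  rw [ind_iff.1 hA] at h2
  refine ⟨by omega, ind_iff.2 (by omega), ?_⟩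
  exact (Submodule.eq_of_le_of_finrank_eq hle (by omega)).symm

theorem Id_union {A B : Finset (Proj 2)} {d : ℕ} (h : IdZ d A = IdZ d B) :
    IdZ d (A ∪ B) = IdZ d A := by
  ext F
  constructor
  · intro hF
    rw [mem_Id] at hF ⊢
    exact fun P hP => hF P (Finset.mem_union_left _ hP)
  · intro hF
    have hF2 := h ▸ hF
    rw [mem_Id] at hF hF2 ⊢
    intro P hP
    rcases Finset.mem_union.1 hP with h' | h'
    · exact hF P h'
    · exact hF2 P h'

theorem exists_quartic {Z : Finset (Proj 2)} (h : 0 < Module.finrank ℂ (IdZ 4 Z)) :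
    ∃ Q : MvPolynomial (Fin 3) ℂ, Q ≠ 0 ∧ Q.IsHomogeneous 4 ∧
      ∀ P ∈ Z, MvPolynomial.eval P.rep Q = 0 := by
  have hne : IdZ 4 Z ≠ ⊥ := by
    intro h'
    rw [h', finrank_bot] at h
    exact lt_irrefl _ h
  obtain ⟨Q, hQ, hQ0⟩ := Submodule.exists_mem_ne_zero_of_ne_bot hne
  exact ⟨Q.1, fun h => hQ0 (Subtype.ext h), Q.2, mem_Id.1 hQ⟩

/-- The two sets must have `14` points off each other. -/
theorem card_ge {A B : Finset (Proj 2)} {c : Proj 2 → ℂ} (hdis : Disjoint A B)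
    (hcA : ∀ P ∈ A, c P ≠ 0)
    (hrel : ∀ F : MvPolynomial (Fin 3) ℂ, F.IsHomogeneous 8 →
      ∑ P ∈ A ∪ B, c P * MvPolynomial.eval P.rep F = 0) (hA : Ind 4 A)
    (hk : ∀ A' ⊆ A, A'.card ≤ 10 → Ind 3 A')
    (hBA : B.card ≤ A.card) (hne : A.Nonempty) : 14 ≤ A.card := by
  obtain ⟨hc, hB, hI⟩ := pairing_main hcA hrel hA hBA
  by_contra hlt
  by_cases h10 : A.card ≤ 10
  · obtain ⟨P, hP⟩ := hne
    obtain ⟨F, hF, hF1, hF2⟩ := (hk A (Finset.Subset.refl _) h10).exists_form hP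
    have hFB : ∀ R ∈ B, MvPolynomial.eval R.rep F = 0 := by
      intro R hR
      have hRP : R ≠ P := by
        rintro rfl
        exact Finset.disjoint_left.1 hdis hP hR
      obtain ⟨L, hL, hL1, hL2⟩ := exists_line hRP
      have hmem : (⟨L * F, hL.mul hF⟩ : Sd 4) ∈ IdZ 4 A := by
        rw [mem_Id]
        intro S hS
        by_cases hSP : S = P
        · subst hSP
          simp [hL1]
        · simp [hF2 S hS hSP]
      rw [hI, mem_Id] at hmem
      have := hmem R hR
      rw [map_mul] at this
      exact (mul_eq_zero.1 this).resolve_left hL2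
    obtain ⟨i, hi⟩ := exists_X_ne P
    have h := hrel (F * MvPolynomial.X i ^ 5) (hF.mul (MvPolynomial.isHomogeneous_X_pow i 5))
    rw [Finset.sum_eq_single P] at h
    · simp only [map_mul, hF1, map_pow, MvPolynomial.eval_X, one_mul] at h
      exact mul_ne_zero (hcA P hP) (pow_ne_zero 5 hi) h
    · intro R hR hRP
      rw [map_mul]
      rcases Finset.mem_union.1 hR with h' | h'
      · rw [hF2 R h' hRP]; simp
      · rw [hFB R h']; simp
    · intro hn
      exact absurd (Finset.mem_union_left _ hP) hn
  · have h1 := finrank_Id 4 A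
    rw [ind_iff.1 hA, ← Id_union hI] at h1
    have h15 : (4 + 2).choose 2 = 15 := by decide
    obtain ⟨Q, hQ0, hQ, hQZ⟩ := exists_quartic (Z := A ∪ B) (by omega)
    have h2 := finrank_of_dvd (j := 4) (k := 0) rfl hQ0 hQ hQZ (fun F hF hFZ =>
      main_dvd hdis hk hB hc le_rfl (Or.inr ⟨by omega, rfl⟩) hQ0 hQ hF hQZ hFZ)
    have h3 : (0 + 2).choose 2 = 1 := by decide
    omega

/-! ### Relations generated by one relation with full support -/

/-- `F ↦ F · c`. -/
def mulC {Z : Finset (Proj 2)} (c : Z → ℂ) (m : ℕ) : Sd m →ₗ[ℂ] (Z → ℂ) where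
  toFun F := fun P => MvPolynomial.eval P.1.rep F.1 * c P
  map_add' F G := by funext P; simp [add_mul]
  map_smul' a F := by funext P; simp [mul_assoc]

theorem mulC_inj {Z : Finset (Proj 2)} {c : Z → ℂ} (hc : ∀ P, c P ≠ 0) {m : ℕ}
    (hI : IdZ m Z = ⊥) : Function.Injective (mulC c m) := by
  rw [← LinearMap.ker_eq_bot, eq_bot_iff, ← hI]
  intro F hF
  rw [LinearMap.mem_ker] at hF
  rw [mem_Id]
  intro P hP
  have := congrFun hF ⟨P, hP⟩
  exact (mul_eq_zero.1 this).resolve_right (hc _)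

theorem cross_eq {Z : Finset (Proj 2)} {c c' : Z → ℂ} (hc : ∀ P, c P ≠ 0) {m k : ℕ}
    (hI : IdZ (m + 1) Z = ⊥) (hk : RelZ k Z ≤ LinearMap.range (mulC c m))
    (hc' : c' ∈ RelZ (k + 1) Z) :
    ∃ q : Fin 3 → Sd m, (∀ i (P : Z), P.1.rep i * c' P = MvPolynomial.eval P.1.rep (q i).1 * c P) ∧
      ∀ i j, MvPolynomial.X j * (q i).1 = MvPolynomial.X i * (q j).1 := by
  have h1 : ∀ i : Fin 3, ∃ q : Sd m,
      ∀ P : Z, P.1.rep i * c' P = MvPolynomial.eval P.1.rep q.1 * c P := by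
    intro i
    obtain ⟨q, hq⟩ := hk (mul_Rel (j := k) hc' (MvPolynomial.isHomogeneous_X ℂ i) (by omega))
    refine ⟨q, fun P => ?_⟩
    have := congrFun hq P
    simp only [MvPolynomial.eval_X] at this
    exact this.symm
  choose q hq using h1
  refine ⟨q, hq, fun i j => ?_⟩
  have hom : (MvPolynomial.X j * (q i).1 - MvPolynomial.X i * (q j).1).IsHomogeneous (m + 1) := by
    apply MvPolynomial.IsHomogeneous.sub
    · rw [add_comm]; exact (MvPolynomial.isHomogeneous_X ℂ j).mul (q i).2
    · rw [add_comm]; exact (MvPolynomial.isHomogeneous_X ℂ i).mul (q j).2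
  have hmem : (⟨_, hom⟩ : Sd (m + 1)) ∈ IdZ (m + 1) Z := by
    rw [mem_Id]
    intro P hP
    simp only [map_sub, map_mul, MvPolynomial.eval_X]
    have e1 := hq i ⟨P, hP⟩
    have e2 := hq j ⟨P, hP⟩
    apply mul_right_cancel₀ (hc ⟨P, hP⟩)
    simp only at e1 e2
    linear_combination (-P.rep j) * e1 + P.rep i * e2
  rw [hI, Submodule.mem_bot] at hmem
  have := congrArg Subtype.val hmem
  exact sub_eq_zero.1 this

theorem rel_step {Z : Finset (Proj 2)} {c : Z → ℂ} (hc : ∀ P, c P ≠ 0) {m k : ℕ}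
    (hI : IdZ (m + 2) Z = ⊥) (hk : RelZ k Z ≤ LinearMap.range (mulC c (m + 1))) :
    RelZ (k + 1) Z ≤ LinearMap.range (mulC c m) := by
  intro c' hc'
  obtain ⟨q, hq, hx⟩ := cross_eq hc hI hk hc'
  have hdvd : (MvPolynomial.X 0 : MvPolynomial (Fin 3) ℂ) ∣ MvPolynomial.X 1 * (q 0).1 :=
    ⟨_, hx 0 1⟩
  have hX : Prime (MvPolynomial.X 0 : MvPolynomial (Fin 3) ℂ) := MvPolynomial.X_prime
  have hd2 : (MvPolynomial.X 0 : MvPolynomial (Fin 3) ℂ) ∣ (q 0).1 := by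
    refine (hX.dvd_or_dvd hdvd).resolve_left ?_
    rw [MvPolynomial.X_dvd_X]
    decide
  obtain ⟨L, hL⟩ := hd2
  have hLh : L.IsHomogeneous m :=
    homog_quot (MvPolynomial.isHomogeneous_X ℂ 0) hX.ne_zero
      (by rw [add_comm 1 m, ← hL]; exact (q 0).2)
  have hqL : ∀ i, (q i).1 = MvPolynomial.X i * L := by
    intro i
    apply mul_left_cancel₀ hX.ne_zero
    rw [← hx 0 i, hL]
    ring
  refine ⟨⟨L, hLh⟩, ?_⟩
  funext P
  obtain ⟨i, hi⟩ := exists_X_ne P.1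
  have h1 := hq i P
  rw [hqL i, map_mul, MvPolynomial.eval_X] at h1
  apply mul_left_cancel₀ hi
  rw [h1]
  change _ * (MvPolynomial.eval P.1.rep L * c P) = _
  ring

theorem rel_end {Z : Finset (Proj 2)} {c : Z → ℂ} (hc : ∀ P, c P ≠ 0) {k : ℕ}
    (hI : IdZ 1 Z = ⊥) (hk : RelZ k Z ≤ LinearMap.range (mulC c 0)) :
    RelZ (k + 1) Z = ⊥ := by
  rw [eq_bot_iff]
  intro c' hc'
  obtain ⟨q, hq, hx⟩ := cross_eq hc hI hk hc'
  have hq0 : ∀ i, (q i).1 = 0 := by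
    intro i
    have h0 := (MvPolynomial.totalDegree_zero_iff_isHomogeneous _).2 (q i).2
    rw [MvPolynomial.totalDegree_eq_zero_iff_eq_C] at h0
    obtain ⟨j, hj⟩ : ∃ j : Fin 3, j ≠ i := exists_ne i
    have h1 := congrArg (MvPolynomial.eval (Pi.single j (1 : ℂ))) (hx i j)
    rw [h0] at h1
    simp only [map_mul, MvPolynomial.eval_X, MvPolynomial.eval_C, Pi.single_eq_same, one_mul,
      Pi.single_eq_of_ne hj.symm, zero_mul] at h1
    rw [h0, h1, map_zero]
  rw [Submodule.mem_bot]
  funext P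
  obtain ⟨i, hi⟩ := exists_X_ne P.1
  have h1 := hq i P
  rw [hq0 i, map_zero, zero_mul] at h1
  exact (mul_eq_zero.1 h1).resolve_left hi

theorem rel_bot_succ {Z : Finset (Proj 2)} {k : ℕ} (h : RelZ k Z = ⊥) : RelZ (k + 1) Z = ⊥ := by
  rw [eq_bot_iff]
  intro c' hc'
  rw [Submodule.mem_bot]
  funext P
  obtain ⟨i, hi⟩ := exists_X_ne P.1
  have h1 := mul_Rel (j := k) hc' (MvPolynomial.isHomogeneous_X ℂ i) (by omega)
  rw [h, Submodule.mem_bot] at h1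
  have h2 := congrFun h1 P
  simp only [MvPolynomial.eval_X] at h2
  exact (mul_eq_zero.1 h2).resolve_left hi

/-! ### Non-redundant decompositions -/

theorem nr_coeffs {A : Finset (Proj 2)} {d : ℕ} {T : MvPolynomial (Fin 3) ℂ}
    (h : NRComputes 2 d A T) :
    ∃ a : Proj 2 → ℂ, ∑ P ∈ A, a P • vero 2 d P = T ∧ ∀ P ∈ A, a P ≠ 0 := by
  classical
  obtain ⟨h1, h2⟩ := h
  obtain ⟨a, ha⟩ := Submodule.mem_span_image_finset_iff_exists_fun ℂ |>.1 h1
  let a' : Proj 2 → ℂ := fun P => if hP : P ∈ A then a ⟨P, hP⟩ else 0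
  have hsum : ∑ P ∈ A, a' P • vero 2 d P = T := by
    rw [← ha, ← Finset.sum_coe_sort]
    apply Finset.sum_congr rfl
    intro P _
    simp [a']
  refine ⟨a', hsum, ?_⟩
  intro P hP h0
  apply h2 (A.erase P) (Finset.erase_ssubset hP)
  rw [Computes, ← hsum, ← Finset.add_sum_erase A _ hP, h0, zero_smul, zero_add]
  apply Submodule.sum_mem
  intro Q hQ
  apply Submodule.smul_mem
  apply Submodule.subset_span
  exact ⟨Q, hQ, rfl⟩

theorem Dhilb_zero (Z : Finset (Proj 2)) : Dhilb 2 Z 0 = hilbN 2 Z 0 := by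
  simp [Dhilb, hilb]

theorem Dhilb_succ (Z : Finset (Proj 2)) (n : ℕ) :
    Dhilb 2 Z ((n : ℤ) + 1) = (hilbN 2 Z (n + 1) : ℤ) - hilbN 2 Z n := by
  have h1 : ¬ ((n : ℤ) + 1 < 0) := by omega
  have h2 : ¬ ((n : ℤ) < 0) := by omega
  have h3 : ((n : ℤ) + 1).toNat = n + 1 := by omega
  simp only [Dhilb, hilb, add_sub_cancel_right, if_neg h1, if_neg h2, h3, Int.toNat_natCast]

/-- Hilbert function in the disjoint situation. -/
theorem hilb_values {A B : Finset (Proj 2)} {c : Proj 2 → ℂ} (hdis : Disjoint A B)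
    (hcA : ∀ P ∈ A, c P ≠ 0) (hcB : ∀ P ∈ B, c P ≠ 0)
    (hrel : ∀ F : MvPolynomial (Fin 3) ℂ, F.IsHomogeneous 8 →
      ∑ P ∈ A ∪ B, c P * MvPolynomial.eval P.rep F = 0) (hA : Ind 4 A)
    (hk : ∀ A' ⊆ A, A'.card ≤ 10 → Ind 3 A')
    (hAc : A.card = 14) (hBc : B.card = 14) :
    hilbN 2 (A ∪ B) 0 = 1 ∧ hilbN 2 (A ∪ B) 1 = 3 ∧ hilbN 2 (A ∪ B) 2 = 6 ∧
    hilbN 2 (A ∪ B) 3 = 10 ∧ hilbN 2 (A ∪ B) 4 = 14 ∧ hilbN 2 (A ∪ B) 5 = 18 ∧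
    hilbN 2 (A ∪ B) 6 = 22 ∧ hilbN 2 (A ∪ B) 7 = 25 ∧ hilbN 2 (A ∪ B) 8 = 27 ∧
    ∀ j, 9 ≤ j → hilbN 2 (A ∪ B) j = 28 := by
  obtain ⟨hcard, hB, hI⟩ := pairing_main hcA hrel hA (by omega)
  have hZc : (A ∪ B).card = 28 := by rw [Finset.card_union_of_disjoint hdis]; omega
  have c0 : (0 + 2).choose 2 = 1 := by decide
  have c1 : (1 + 2).choose 2 = 3 := by decide
  have c2 : (2 + 2).choose 2 = 6 := by decide
  have c3 : (3 + 2).choose 2 = 10 := by decide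
  have c4 : (4 + 2).choose 2 = 15 := by decide
  have c5 : (5 + 2).choose 2 = 21 := by decide
  have c6 : (6 + 2).choose 2 = 28 := by decide
  -- no forms of degree at most three
  have hbot : ∀ e, e ≤ 3 → IdZ e (A ∪ B) = ⊥ := by
    intro e he
    rw [eq_bot_iff]
    intro F hF
    rw [mem_Id] at hF
    by_contra hF0
    have h1 : F.1 ≠ 0 := fun h => hF0 ((Submodule.mem_bot ℂ).2 (Subtype.ext h))
    have := curve_bound hk (show e + (3 - e) = 3 by omega) F.2 h1 (Finset.Subset.refl A)
      (fun P hP => hF P (Finset.mem_union_left _ hP))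
    omega
  have d0 := finrank_Id 0 (A ∪ B)
  have d1 := finrank_Id 1 (A ∪ B)
  have d2 := finrank_Id 2 (A ∪ B)
  have d3 := finrank_Id 3 (A ∪ B)
  rw [hbot _ (by omega), finrank_bot] at d0 d1 d2 d3
  have d4 := finrank_Id 4 (A ∪ B)
  have d4' := finrank_Id 4 A
  rw [ind_iff.1 hA, ← Id_union hI] at d4'
  obtain ⟨Q, hQ0, hQ, hQZ⟩ := exists_quartic (Z := A ∪ B) (by omega)
  have f5 := finrank_of_dvd (j := 5) (k := 1) rfl hQ0 hQ hQZ (fun F hF hFZ =>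
    main_dvd hdis hk hB hcard (by omega) (Or.inl ⟨hAc, by omega⟩) hQ0 hQ hF hQZ hFZ)
  have f6 := finrank_of_dvd (j := 6) (k := 2) rfl hQ0 hQ hQZ (fun F hF hFZ =>
    main_dvd hdis hk hB hcard (by omega) (Or.inl ⟨hAc, by omega⟩) hQ0 hQ hF hQZ hFZ)
  have d5 := finrank_Id 5 (A ∪ B)
  have d6 := finrank_Id 6 (A ∪ B)
  -- the relation
  let c' : (A ∪ B : Finset (Proj 2)) → ℂ := fun P => c P.1
  have hc' : ∀ P, c' P ≠ 0 := by
    intro P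
    rcases Finset.mem_union.1 P.2 with h | h
    · exact hcA _ h
    · exact hcB _ h
  have hc8 : c' ∈ RelZ 8 (A ∪ B) := by
    rw [mem_Rel]
    intro F hF
    rw [← hrel F hF, ← Finset.sum_coe_sort (A ∪ B)]
  have hle : ∀ m k, m + k = 8 → LinearMap.range (mulC c' m) ≤ RelZ k (A ∪ B) := by
    rintro m k hmk _ ⟨F, rfl⟩
    exact mul_Rel hc8 F.2 hmk
  have hfr : ∀ m, m ≤ 3 → Module.finrank ℂ (LinearMap.range (mulC c' m)) = (m + 2).choose 2 := by
    intro m hm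
    rw [LinearMap.finrank_range_of_inj (mulC_inj hc' (hbot m hm)), finrank_Sd]
  have r6 := finrank_Rel 6 (A ∪ B)
  have r7 := finrank_Rel 7 (A ∪ B)
  have r8 := finrank_Rel 8 (A ∪ B)
  have g0 := hfr 0 (by omega)
  have g1 := hfr 1 (by omega)
  have g2 := hfr 2 (by omega)
  have e6 : LinearMap.range (mulC c' 2) = RelZ 6 (A ∪ B) :=
    Submodule.eq_of_le_of_finrank_eq (hle 2 6 rfl) (by omega)
  have e7 : RelZ 7 (A ∪ B) = LinearMap.range (mulC c' 1) :=
    le_antisymm (rel_step hc' (hbot 3 le_rfl) e6.ge) (hle 1 7 rfl)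
  have e8 : RelZ 8 (A ∪ B) = LinearMap.range (mulC c' 0) :=
    le_antisymm (rel_step hc' (hbot 2 (by omega)) e7.le) (hle 0 8 rfl)
  have e9 : RelZ 9 (A ∪ B) = ⊥ := rel_end hc' (hbot 1 (by omega)) e8.le
  rw [e7] at r7
  rw [e8] at r8
  refine ⟨by omega, by omega, by omega, by omega, by omega, by omega, by omega, by omega,
    by omega, ?_⟩
  intro j hj
  have hb : RelZ j (A ∪ B) = ⊥ := by
    induction j, hj using Nat.le_induction with
    | base => exact e9
    | succ n _ ih => exact rel_bot_succ ih
  have rj := finrank_Rel j (A ∪ B)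
  rw [hb, finrank_bot] at rj
  omega

end helpers

/-- Claim: in the degree `8`, length `14` situation, `A ∩ B = ∅`, `ℓ(Z) = 28` and the
first difference of the Hilbert function of `Z = A ∪ B` is `1,2,3,4,4,4,4,3,2,1,0,…`. -/
theorem stmt10
    (T : MvPolynomial (Fin 3) ℂ) (hT0 : T ≠ 0) (hTh : T.IsHomogeneous 8)
    (A : Finset (Proj 2)) (hA : NRComputes 2 8 A T) (hAc : A.card = 14)
    (hk : kruskalRank 2 3 A = 10) (hh : hilbN 2 A 4 = 14)
    (B : Finset (Proj 2)) (hB : NRComputes 2 8 B T) (hBc : B.card = 14) (hBA : B ≠ A) :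
    A ∩ B = ∅ ∧ (A ∪ B).card = 28 ∧
    Dhilb 2 (A ∪ B) 0 = 1 ∧ Dhilb 2 (A ∪ B) 1 = 2 ∧ Dhilb 2 (A ∪ B) 2 = 3 ∧
    Dhilb 2 (A ∪ B) 3 = 4 ∧ Dhilb 2 (A ∪ B) 4 = 4 ∧ Dhilb 2 (A ∪ B) 5 = 4 ∧
    Dhilb 2 (A ∪ B) 6 = 4 ∧ Dhilb 2 (A ∪ B) 7 = 3 ∧ Dhilb 2 (A ∪ B) 8 = 2 ∧
    Dhilb 2 (A ∪ B) 9 = 1 ∧ ∀ j : ℤ, 10 ≤ j → Dhilb 2 (A ∪ B) j = 0 := by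
  classical
  have hk3 := kruskal_ind hk
  have hA4 : Ind 4 A := ind_iff.2 (hh.trans hAc.symm)
  obtain ⟨a, haT, ha0⟩ := nr_coeffs hA
  obtain ⟨b, hbT, hb0⟩ := nr_coeffs hB
  let c : Proj 2 → ℂ := fun P => (if P ∈ A then a P else 0) - (if P ∈ B then b P else 0)
  have hcsum : ∑ P ∈ A ∪ B, c P • vero 2 8 P = 0 := by
    have h1 : ∑ P ∈ A ∪ B, (if P ∈ A then a P else 0) • vero 2 8 P = T := by
      rw [← haT, ← Finset.sum_subset (Finset.subset_union_left (s₁ := A) (s₂ := B))]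
      · exact Finset.sum_congr rfl (fun P hP => by rw [if_pos hP])
      · intro P _ hP
        rw [if_neg hP, zero_smul]
    have h2 : ∑ P ∈ A ∪ B, (if P ∈ B then b P else 0) • vero 2 8 P = T := by
      rw [← hbT, ← Finset.sum_subset (Finset.subset_union_right (s₁ := A) (s₂ := B))]
      · exact Finset.sum_congr rfl (fun P hP => by rw [if_pos hP])
      · intro P _ hP
        rw [if_neg hP, zero_smul]
    simp only [c, sub_smul, Finset.sum_sub_distrib, h1, h2, sub_self]
  let A' := A.filter (fun P => c P ≠ 0)
  let B' := B \ A
  have hA'A : A' ⊆ A := Finset.filter_subset _ _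
  have hdis : Disjoint A' B' :=
    Finset.disjoint_left.2 (fun P hP hP' => (Finset.mem_sdiff.1 hP').2 (hA'A hP))
  have hcB' : ∀ P ∈ B', c P ≠ 0 := by
    intro P hP
    obtain ⟨h1, h2⟩ := Finset.mem_sdiff.1 hP
    simp only [c, if_neg h2, if_pos h1, zero_sub]
    exact neg_ne_zero.2 (hb0 P h1)
  have hcA' : ∀ P ∈ A', c P ≠ 0 := fun P hP => (Finset.mem_filter.1 hP).2
  have hsub : A \ B ⊆ A' := by
    intro P hP
    obtain ⟨h1, h2⟩ := Finset.mem_sdiff.1 hP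
    refine Finset.mem_filter.2 ⟨h1, ?_⟩
    simp only [c, if_neg h2, if_pos h1, sub_zero]
    exact ha0 P h1
  have hcsum' : ∑ P ∈ A' ∪ B', c P • vero 2 8 P = 0 := by
    rw [← hcsum]
    apply Finset.sum_subset
    · exact Finset.union_subset_union hA'A Finset.sdiff_subset
    · intro P hP hP'
      rw [Finset.mem_union, not_or] at hP'
      have hPA : P ∈ A := by
        by_contra hn
        exact hP'.2 (Finset.mem_sdiff.2 ⟨(Finset.mem_union.1 hP).resolve_left hn, hn⟩)
      have : c P = 0 := by
        by_contra hn
        exact hP'.1 (Finset.mem_filter.2 ⟨hPA, hn⟩)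
      rw [this, zero_smul]
  have hrel : ∀ F : MvPolynomial (Fin 3) ℂ, F.IsHomogeneous 8 →
      ∑ P ∈ A' ∪ B', c P * MvPolynomial.eval P.rep F = 0 :=
    fun F hF => rel_of_vero hcsum' hF
  have q1 := Finset.card_le_card hsub
  have q2 := Finset.card_sdiff_add_card_inter A B
  have q3 := Finset.card_sdiff_add_card_inter B A
  have q4 : (B ∩ A).card = (A ∩ B).card := by rw [Finset.inter_comm]
  have q5 : B'.card = (B \ A).card := rfl
  have hne : A'.Nonempty := by
    refine Finset.Nonempty.mono hsub ?_
    rw [Finset.sdiff_nonempty]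
    intro hAB
    exact hBA (Finset.eq_of_subset_of_card_le hAB (by omega)).symm
  have hA'4 := hA4.mono hA'A
  have hk' : ∀ Y ⊆ A', Y.card ≤ 10 → Ind 3 Y := fun Y hY => hk3 Y (hY.trans hA'A)
  have hge := card_ge hdis hcA' hrel hA'4 hk' (by omega) hne
  obtain ⟨hcd, -, -⟩ := pairing_main hcA' hrel hA'4 (by omega)
  have hA'eq : A' = A := Finset.eq_of_subset_of_card_le hA'A (by omega)
  have hB'eq : B' = B := Finset.eq_of_subset_of_card_le Finset.sdiff_subset (by omega)
  rw [hA'eq, hB'eq] at hdis hrel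
  rw [hA'eq] at hcA'
  rw [hB'eq] at hcB'
  obtain ⟨v0, v1, v2, v3, v4, v5, v6, v7, v8, v9⟩ :=
    hilb_values hdis hcA' hcB' hrel hA4 hk3 hAc hBc
  have w9 := v9 9 le_rfl
  refine ⟨Finset.disjoint_iff_inter_eq_empty.1 hdis, ?_, ?_, ?_, ?_, ?_, ?_, ?_, ?_, ?_, ?_, ?_, ?_⟩
  · rw [Finset.card_union_of_disjoint hdis]; omega
  · rw [Dhilb_zero, v0]; rfl
  · have := Dhilb_succ (A ∪ B) 0
    simp only [zero_add, v0, v1] at this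
    exact this
  · have := Dhilb_succ (A ∪ B) 1
    rw [v1, v2] at this
    exact this
  · have := Dhilb_succ (A ∪ B) 2
    rw [v2, v3] at this
    exact this
  · have := Dhilb_succ (A ∪ B) 3
    rw [v3, v4] at this
    exact this
  · have := Dhilb_succ (A ∪ B) 4
    rw [v4, v5] at this
    exact this
  · have := Dhilb_succ (A ∪ B) 5
    rw [v5, v6] at this
    exact this
  · have := Dhilb_succ (A ∪ B) 6
    rw [v6, v7] at this
    exact this
  · have := Dhilb_succ (A ∪ B) 7
    rw [v7, v8] at this
    exact this
  · have := Dhilb_succ (A ∪ B) 8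
    rw [v8, w9] at this
    exact this
  · intro j hj
    obtain ⟨n, rfl⟩ : ∃ n : ℕ, j = (n : ℤ) + 1 := ⟨(j - 1).toNat, by omega⟩
    rw [Dhilb_succ, v9 n (by omega), v9 (n + 1) (by omega)]
    simp
end

section
/- Let T ∈ S⁸ ℂ³ be a nonzero ternary form of degree 8 and let A ⊆ ℙ²(ℂ) be a non-redundant finite set computing T with ℓ(A) = 14, k₃(A) = 10, and h_A(4) = 14. Let B ⊆ ℙ²(ℂ) be another non-redundant finite set computing T with ℓ(B) = 14 and B ≠ A, and set Z = A ∪ B. Then Z is a complete intersection of type (4,7): there exist homogeneous ternary forms Q of degree 4 and S of degree 7 that generate the saturated homogeneous ideal of Z, i.e. Z is exactly the common zero locus of Q and S (28 distinct points) and every homogeneous form vanishing on Z lies in the ideal generated by Q and S. -/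
open MvPolynomial

/-! ### Graded pieces -/

theorem aux_finrank_H (j : ℕ) :
    Module.finrank ℂ (homogeneousSubmodule (Fin 3) ℂ j) = (j + 2).choose 2 := by
  have e1 : {d : Fin 3 →₀ ℕ | d.degree = j} =
      ((Finset.univ : Finset (Fin 3)).finsuppAntidiag j : Set (Fin 3 →₀ ℕ)) := by
    ext d
    simp [Finsupp.degree_eq_sum]
  rw [homogeneousSubmodule_eq_finsupp_supported, e1]
  have e2 := (AddMonoidAlgebra.supportedEquivFinsupp (R := ℂ) (S := ℂ)
    ((Finset.univ : Finset (Fin 3)).finsuppAntidiag j : Set (Fin 3 →₀ ℕ))).finrank_eq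
  rw [e2, Module.finrank_finsupp_self]
  simp only [Finset.coe_sort_coe, Fintype.card_coe]
  rw [Finset.card_finsuppAntidiag_nat_eq_choose]
  simp only [Finset.card_univ, Fintype.card_fin]
  have : 3 + j - 1 = j + 2 := by omega
  rw [this, ← Nat.choose_symm_add]

instance aux_fin_H (j : ℕ) : Module.Finite ℂ (homogeneousSubmodule (Fin 3) ℂ j) :=
  Module.Finite.iff_fg.mpr (homogeneousSubmodule_fg _ _ _)

theorem aux_comp_mul {a : ℕ} {F : MvPolynomial (Fin 3) ℂ} (hF : F.IsHomogeneous a)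
    (u : MvPolynomial (Fin 3) ℂ) (j : ℕ) :
    homogeneousComponent j (u * F) =
      if a ≤ j then homogeneousComponent (j - a) u * F else 0 := by
  conv_lhs => rw [← sum_homogeneousComponent u]
  rw [Finset.sum_mul, map_sum]
  have h1 : ∀ k ∈ Finset.range (u.totalDegree + 1),
      homogeneousComponent j (homogeneousComponent k u * F) =
        if k + a = j then homogeneousComponent k u * F else 0 := by
    intro k _
    have h2 : (homogeneousComponent k u * F).IsHomogeneous (k + a) :=
      (homogeneousComponent_isHomogeneous k u).mul hF
    split_ifs with h3
    · exact homogeneousComponent_eq_self (h3 ▸ h2)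
    · rw [homogeneousComponent_of_mem h2, if_neg (fun h => h3 h.symm)]
  rw [Finset.sum_congr rfl h1]
  split_ifs with h4
  · have h5 : ∀ k, (k + a = j) = (j - a = k) := fun k => by
      apply propext; omega
    simp only [h5]
    rw [Finset.sum_ite_eq]
    split_ifs with h6
    · rfl
    · rw [homogeneousComponent_eq_zero, zero_mul]
      simp at h6
      omega
  · refine Finset.sum_eq_zero fun k _ => if_neg (by omega)

/-- degree `j` multiples of `F`. -/
noncomputable def auxM (F : MvPolynomial (Fin 3) ℂ) (j : ℕ) :
    Submodule ℂ (MvPolynomial (Fin 3) ℂ) :=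
  homogeneousSubmodule (Fin 3) ℂ j ⊓ (Ideal.span {F}).restrictScalars ℂ

theorem aux_mem_M {F f : MvPolynomial (Fin 3) ℂ} {j : ℕ} :
    f ∈ auxM F j ↔ f.IsHomogeneous j ∧ F ∣ f := by
  simp [auxM, Ideal.mem_span_singleton]

theorem aux_finrank_M {a : ℕ} {F : MvPolynomial (Fin 3) ℂ} (hF : F.IsHomogeneous a)
    (hF0 : F ≠ 0) (j : ℕ) :
    Module.finrank ℂ (auxM F j) = (j + 2 - a).choose 2 := by
  by_cases haj : a ≤ j
  · have e : auxM F j = (homogeneousSubmodule (Fin 3) ℂ (j - a)).map (LinearMap.mulLeft ℂ F) := by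
      ext f
      rw [aux_mem_M]
      constructor
      · rintro ⟨h1, u, rfl⟩
        refine ⟨homogeneousComponent (j - a) u, homogeneousComponent_isHomogeneous _ _, ?_⟩
        have := aux_comp_mul hF u j
        rw [if_pos haj, mul_comm, homogeneousComponent_eq_self h1] at this
        simp only [LinearMap.mulLeft_apply]
        rw [this, mul_comm]
      · rintro ⟨u, hu, rfl⟩
        refine ⟨?_, Dvd.intro _ rfl⟩
        have := hF.mul hu
        rwa [Nat.add_sub_cancel' haj] at this
    rw [e, (Submodule.equivMapOfInjective _ (mul_right_injective₀ hF0) _).finrank_eq.symm, aux_finrank_H]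
    congr 1
    omega
  · have e : auxM F j = ⊥ := by
      rw [eq_bot_iff]
      intro f
      rw [aux_mem_M]
      rintro ⟨h1, u, rfl⟩
      have := aux_comp_mul hF u j
      rw [if_neg haj, mul_comm, homogeneousComponent_eq_self h1] at this
      simpa using this
    rw [e, finrank_bot, Nat.choose_eq_zero_of_lt]
    omega

/-- degree `j` part of the ideal `(F,Q)`. -/
noncomputable def auxJ (F Q : MvPolynomial (Fin 3) ℂ) (j : ℕ) :
    Submodule ℂ (MvPolynomial (Fin 3) ℂ) :=
  homogeneousSubmodule (Fin 3) ℂ j ⊓ (Ideal.span {F, Q}).restrictScalars ℂ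

theorem aux_mem_J {F Q f : MvPolynomial (Fin 3) ℂ} {j : ℕ} :
    f ∈ auxJ F Q j ↔ f.IsHomogeneous j ∧ f ∈ Ideal.span {F, Q} := by
  simp [auxJ]

theorem aux_J_eq {a b : ℕ} {F Q : MvPolynomial (Fin 3) ℂ} (hF : F.IsHomogeneous a)
    (hQ : Q.IsHomogeneous b) (j : ℕ) : auxJ F Q j = auxM F j ⊔ auxM Q j := by
  apply le_antisymm
  · intro f hf
    obtain ⟨h1, h2⟩ := aux_mem_J.1 hf
    obtain ⟨u, v, rfl⟩ := Ideal.mem_span_pair.1 h2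
    have h3 := homogeneousComponent_eq_self h1
    rw [map_add] at h3
    rw [← h3]
    refine Submodule.add_mem_sup (aux_mem_M.2 ⟨homogeneousComponent_isHomogeneous _ _, ?_⟩)
      (aux_mem_M.2 ⟨homogeneousComponent_isHomogeneous _ _, ?_⟩)
    · rw [aux_comp_mul hF]; split_ifs <;> simp
    · rw [aux_comp_mul hQ]; split_ifs <;> simp
  · apply sup_le
    · exact inf_le_inf_left _ (Ideal.span_mono (by simp))
    · exact inf_le_inf_left _ (Ideal.span_mono (by simp))

theorem aux_M_inf {F Q : MvPolynomial (Fin 3) ℂ} (h : IsRelPrime F Q) (j : ℕ) :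
    auxM F j ⊓ auxM Q j = auxM (F * Q) j := by
  ext f
  simp only [Submodule.mem_inf, aux_mem_M]
  constructor
  · rintro ⟨⟨h1, h2⟩, _, h3⟩
    exact ⟨h1, h.mul_dvd h2 h3⟩
  · rintro ⟨h1, h2⟩
    exact ⟨⟨h1, (Dvd.intro _ rfl).trans h2⟩, h1, (Dvd.intro_left _ rfl).trans h2⟩

theorem aux_fin_sub {U : Submodule ℂ (MvPolynomial (Fin 3) ℂ)} {j : ℕ}
    (h : U ≤ homogeneousSubmodule (Fin 3) ℂ j) : Module.Finite ℂ U :=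
  Submodule.finiteDimensional_of_le h

theorem aux_choose_id (a b m : ℕ) :
    (m + b).choose 2 + (m + a).choose 2 + a * b = m.choose 2 + (m + a + b).choose 2 := by
  have h : ∀ n : ℕ, ((n.choose 2 : ℕ) : ℚ) = n * (n - 1) / 2 := fun n => Nat.cast_choose_two ℚ n
  have : (((m + b).choose 2 + (m + a).choose 2 + a * b : ℕ) : ℚ)
      = ((m.choose 2 + (m + a + b).choose 2 : ℕ) : ℚ) := by
    push_cast [h]
    ring
  exact_mod_cast this

theorem aux_finrank_J {a b : ℕ} {F Q : MvPolynomial (Fin 3) ℂ} (hF : F.IsHomogeneous a)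
    (hQ : Q.IsHomogeneous b) (hF0 : F ≠ 0) (hQ0 : Q ≠ 0) (h : IsRelPrime F Q) (j : ℕ)
    (hj : a + b ≤ j + 2) :
    Module.finrank ℂ (auxJ F Q j) + a * b = (j + 2).choose 2 := by
  have : Module.Finite ℂ (auxM F j) := aux_fin_sub inf_le_left
  have : Module.Finite ℂ (auxM Q j) := aux_fin_sub inf_le_left
  have h1 := Submodule.finrank_sup_add_finrank_inf_eq (auxM F j) (auxM Q j)
  rw [← aux_J_eq hF hQ, aux_M_inf h, aux_finrank_M hF hF0, aux_finrank_M hQ hQ0,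
    aux_finrank_M (hF.mul hQ) (mul_ne_zero hF0 hQ0)] at h1
  obtain ⟨m, hm⟩ := Nat.exists_eq_add_of_le hj
  have h2 := aux_choose_id a b m
  have e1 : j + 2 - (a + b) = m := by omega
  have e2 : j + 2 - a = m + b := by omega
  have e3 : j + 2 - b = m + a := by omega
  have e4 : j + 2 = m + a + b := by omega
  rw [e1, e2, e3] at h1
  rw [e4]
  omega

/-- Factors of homogeneous polynomials are homogeneous. -/
theorem aux_factor_hom {n : ℕ} {f g : MvPolynomial (Fin 3) ℂ} (h : (f * g).IsHomogeneous n)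
    (h0 : f * g ≠ 0) : ∃ k l, k + l = n ∧ f.IsHomogeneous k ∧ g.IsHomogeneous l := by
  let φ : MvPolynomial (Fin 3) ℂ →ₐ[ℂ] Polynomial (MvPolynomial (Fin 3) ℂ) :=
    aeval (fun i => Polynomial.C (X i) * Polynomial.X)
  have hφ : ∀ (m : ℕ) (p : MvPolynomial (Fin 3) ℂ), p.IsHomogeneous m →
      φ p = Polynomial.C p * Polynomial.X ^ m := by
    intro m p hp
    conv_lhs => rw [p.as_sum]
    conv_rhs => rw [p.as_sum]
    rw [map_sum, map_sum, Finset.sum_mul]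
    refine Finset.sum_congr rfl fun d hd => ?_
    have hd' : d.degree = m := by
      by_contra hne
      exact (mem_support_iff.1 hd) (hp.coeff_eq_zero hne)
    simp only [φ, aeval_monomial, mul_pow, Finsupp.prod_mul]
    rw [monomial_eq, map_mul, Finsupp.prod, Finsupp.prod, Finsupp.prod, map_prod,
      Finset.prod_pow_eq_pow_sum]
    have : ∑ i ∈ d.support, d i = m := by rw [← hd']; rfl
    rw [this]
    simp only [map_pow]
    rw [mul_assoc]
    rfl
  have hco : ∀ (p : MvPolynomial (Fin 3) ℂ) (i : ℕ), (φ p).coeff i = homogeneousComponent i p := by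
    intro p i
    conv_lhs => rw [← sum_homogeneousComponent p]
    rw [map_sum, Polynomial.finsetSum_coeff]
    have : ∀ k ∈ Finset.range (p.totalDegree + 1), (φ (homogeneousComponent k p)).coeff i =
        if i = k then homogeneousComponent k p else 0 := by
      intro k _
      rw [hφ k _ (homogeneousComponent_isHomogeneous _ _), Polynomial.coeff_C_mul_X_pow]
    rw [Finset.sum_congr rfl this, Finset.sum_ite_eq]
    split_ifs with hi
    · rfl
    · rw [homogeneousComponent_eq_zero]
      simp at hi
      omega
  have h1 := hφ n _ h
  rw [map_mul] at h1
  have hfg0 : φ f * φ g ≠ 0 := by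
    rw [h1]; exact mul_ne_zero (by simpa using h0) (pow_ne_zero _ Polynomial.X_ne_zero)
  have hf0 := left_ne_zero_of_mul hfg0
  have hg0 := right_ne_zero_of_mul hfg0
  have hd := Polynomial.natDegree_mul hf0 hg0
  have ht := Polynomial.natTrailingDegree_mul hf0 hg0
  rw [h1, Polynomial.natDegree_C_mul_X_pow _ _ h0] at hd
  have : (Polynomial.C (f * g) * Polynomial.X ^ n : Polynomial (MvPolynomial (Fin 3) ℂ)).natTrailingDegree = n := by
    rw [Polynomial.C_mul_X_pow_eq_monomial, Polynomial.natTrailingDegree_monomial h0]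
  rw [h1, this] at ht
  have hf := Polynomial.natTrailingDegree_le_natDegree (φ f)
  have hg := Polynomial.natTrailingDegree_le_natDegree (φ g)
  have key : ∀ p : MvPolynomial (Fin 3) ℂ, (φ p).natTrailingDegree = (φ p).natDegree →
      p.IsHomogeneous (φ p).natDegree := by
    intro p hp
    have : p = homogeneousComponent (φ p).natDegree p := by
      conv_lhs => rw [← sum_homogeneousComponent p]
      by_cases hm : (φ p).natDegree ∈ Finset.range (p.totalDegree + 1)
      · rw [Finset.sum_eq_single_of_mem _ hm]
        intro k _ hk
        rw [← hco]
        rcases lt_or_gt_of_ne hk with h | h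
        · exact Polynomial.coeff_eq_zero_of_lt_natTrailingDegree (by omega)
        · exact Polynomial.coeff_eq_zero_of_natDegree_lt h
      · rw [homogeneousComponent_eq_zero (n := (φ p).natDegree) (h := by simp at hm; omega)]
        refine Finset.sum_eq_zero fun k hk => ?_
        rw [← hco]
        apply Polynomial.coeff_eq_zero_of_lt_natTrailingDegree
        simp at hm hk; omega
    rw [this]
    have e := homogeneousComponent_isHomogeneous (φ p).natDegree p
    rwa [← this]  at e ⊢
  exact ⟨_, _, hd.symm, key f (by omega), key g (by omega)⟩

/-! ### Points and linear forms -/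

theorem aux_eval_lin (w v : Fin 3 → ℂ) : eval v (linForm 2 w) = ∑ i : Fin 3, w i * v i := by
  simp [linForm]

theorem aux_lin_hom (w : Fin 3 → ℂ) : (linForm 2 w).IsHomogeneous 1 := by
  unfold linForm
  exact IsHomogeneous.sum _ _ _ fun i _ => isHomogeneous_C_mul_X _ _

theorem aux_lin_ne {w : Fin 3 → ℂ} (hw : w ≠ 0) : linForm 2 w ≠ 0 := by
  intro h
  apply hw
  funext i
  have := aux_eval_lin w (Pi.single i 1)
  rw [h] at this
  simpa [Pi.single_apply] using this.symm

theorem aux_sep {P P' : Proj 2} (h : P ≠ P') :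
    ∃ w : Fin 3 → ℂ, eval P'.rep (linForm 2 w) = 0 ∧ eval P.rep (linForm 2 w) ≠ 0 := by
  have h1 : P.rep ∉ Submodule.span ℂ {P'.rep} := by
    intro h2
    obtain ⟨a, ha⟩ := Submodule.mem_span_singleton.1 h2
    apply h
    rw [← P.mk_rep, ← P'.mk_rep, Projectivization.mk_eq_mk_iff']
    exact ⟨a, ha⟩
  obtain ⟨f, hf, hf'⟩ := Submodule.exists_dual_map_eq_bot_of_notMem h1 inferInstance
  have key : ∀ v : Fin 3 → ℂ, eval v (linForm 2 fun i => f (Pi.single i 1)) = f v := by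
    intro v
    rw [aux_eval_lin]
    conv_rhs => rw [LinearMap.pi_apply_eq_sum_univ f v]
    refine Finset.sum_congr rfl fun i _ => ?_
    rw [smul_eq_mul, mul_comm]
    congr 2
    funext j
    simp [Pi.single_apply, eq_comm]
  refine ⟨fun i => f (Pi.single i 1), ?_, ?_⟩
  · rw [key]
    have : f P'.rep ∈ (Submodule.span ℂ {P'.rep}).map f :=
      Submodule.mem_map_of_mem (Submodule.mem_span_singleton_self _)
    rw [hf'] at this
    simpa using this
  · rw [key]; exact hf

theorem aux_avoid (W : Finset (Proj 2)) :
    ∃ w : Fin 3 → ℂ, w ≠ 0 ∧ ∀ P ∈ W, eval P.rep (linForm 2 w) ≠ 0 := by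
  have h0 : (X 0 * ∏ P ∈ W, linForm 2 P.rep : MvPolynomial (Fin 3) ℂ) ≠ 0 :=
    mul_ne_zero (X_ne_zero _) (Finset.prod_ne_zero_iff.2 fun P _ => aux_lin_ne P.rep_nonzero)
  have : ∃ w : Fin 3 → ℂ, eval w (X 0 * ∏ P ∈ W, linForm 2 P.rep : MvPolynomial (Fin 3) ℂ) ≠ 0 := by
    by_contra! hcon
    exact h0 (MvPolynomial.funext fun x => by rw [hcon x, map_zero])
  obtain ⟨w, hw⟩ := this
  rw [map_mul, eval_X, map_prod] at hw
  refine ⟨w, ?_, fun P hP => ?_⟩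
  · rintro rfl; simp at hw
  · have := Finset.prod_ne_zero_iff.1 (right_ne_zero_of_mul hw) P hP
    rw [aux_eval_lin] at this ⊢
    simpa [mul_comm] using this

/-- A form of degree `m ≥ |W| - 1` separating a point. -/
theorem aux_sep_form (W : Finset (Proj 2)) (P : Proj 2) (hP : P ∈ W) (m : ℕ) (hm : W.card ≤ m) :
    ∃ f : MvPolynomial (Fin 3) ℂ, f.IsHomogeneous m ∧ eval P.rep f = 1 ∧
      ∀ P' ∈ W, P' ≠ P → eval P'.rep f = 0 := by
  obtain ⟨w, _, hw⟩ := aux_avoid W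
  choose! s hs using fun P' (h : P' ∈ W.erase P) => aux_sep (Finset.ne_of_mem_erase h).symm
  let g : MvPolynomial (Fin 3) ℂ :=
    (∏ P' ∈ W.erase P, linForm 2 (s P')) * linForm 2 w ^ (m - (W.erase P).card)
  have hg : g.IsHomogeneous m := by
    have h1 : (∏ P' ∈ W.erase P, linForm 2 (s P')).IsHomogeneous (∑ P' ∈ W.erase P, 1) :=
      IsHomogeneous.prod _ _ _ fun P' _ => aux_lin_hom _
    have h2 := h1.mul ((aux_lin_hom w).pow (m - (W.erase P).card))
    have h3 : ∑ P' ∈ W.erase P, 1 + 1 * (m - (W.erase P).card) = m := by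
      have := Finset.card_erase_le (s := W) (a := P)
      simp only [Finset.sum_const, smul_eq_mul]
      omega
    rwa [h3] at h2
  have hgP : eval P.rep g ≠ 0 := by
    simp only [g, map_mul, map_prod, map_pow]
    exact mul_ne_zero (Finset.prod_ne_zero_iff.2 fun P' h => (hs P' h).2) (pow_ne_zero _ (hw P hP))
  refine ⟨C (eval P.rep g)⁻¹ * g, hg.C_mul _, by simp [hgP], fun P' h1 h2 => ?_⟩
  have h3 : P' ∈ W.erase P := Finset.mem_erase.2 ⟨h2, h1⟩
  have : eval P'.rep g = 0 := by
    simp only [g, map_mul, map_prod, map_pow]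
    rw [Finset.prod_eq_zero h3 (hs P' h3).1, zero_mul]
  simp [this]

theorem aux_eval_smul {n : ℕ} {F : MvPolynomial (Fin 3) ℂ} (hF : F.IsHomogeneous n) (c : ℂ)
    (v : Fin 3 → ℂ) : eval (c • v) F = c ^ n * eval v F := by
  rw [eval_eq, eval_eq, Finset.mul_sum]
  refine Finset.sum_congr rfl fun d hd => ?_
  have hd' : ∑ i ∈ d.support, d i = n := by
    by_contra hne
    exact (mem_support_iff.1 hd) (hF.coeff_eq_zero hne)
  simp only [Pi.smul_apply, smul_eq_mul, mul_pow, Finset.prod_mul_distrib]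
  rw [Finset.prod_pow_eq_pow_sum, hd']
  ring

theorem aux_zero_proj {n : ℕ} {F : MvPolynomial (Fin 3) ℂ} (hF : F.IsHomogeneous n)
    {v : Fin 3 → ℂ} (hv : v ≠ 0) (h : eval v F = 0) :
    eval (Projectivization.mk ℂ v hv).rep F = 0 := by
  obtain ⟨a, ha⟩ := Projectivization.exists_smul_eq_mk_rep ℂ v hv
  rw [← ha, Units.smul_def, aux_eval_smul hF, h, mul_zero]

theorem aux_X_relprime {i j : Fin 3} (h : i ≠ j) (m n : ℕ) :
    IsRelPrime (X i ^ m : MvPolynomial (Fin 3) ℂ) (X j ^ n) := by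
  apply IsRelPrime.pow
  rw [Irreducible.isRelPrime_iff_not_dvd (MvPolynomial.X_prime).irreducible]
  intro hd
  obtain ⟨u, hu⟩ := hd
  have := congrArg (eval (Pi.single j (1 : ℂ))) hu
  simp [h] at this

/-- A linear form missing the common zeros of `F` and `Q` is a nonzerodivisor modulo `(F, Q)`. -/
theorem aux_nzd {a b : ℕ} {F Q : MvPolynomial (Fin 3) ℂ} (hF : F.IsHomogeneous a)
    (hQ : Q.IsHomogeneous b) (hb : 1 ≤ b) {w : Fin 3 → ℂ} (hw : w ≠ 0)
    (hav : ∀ P : Proj 2, eval P.rep F = 0 → eval P.rep Q = 0 → eval P.rep (linForm 2 w) ≠ 0)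
    (G : MvPolynomial (Fin 3) ℂ) (hG : linForm 2 w * G ∈ Ideal.span {F, Q}) :
    G ∈ Ideal.span {F, Q} := by
  obtain ⟨i, hi⟩ : ∃ i, w i ≠ 0 := by
    by_contra! hcon
    exact hw (_root_.funext hcon)
  set l : MvPolynomial (Fin 3) ℂ := linForm 2 w with hl
  have hl0 : l ≠ 0 := aux_lin_ne hw
  let π : MvPolynomial (Fin 3) ℂ →ₐ[ℂ] MvPolynomial (Fin 3) ℂ :=
    aeval (fun j => X j - C (if j = i then (w i)⁻¹ else 0) * l)
  have hπl : π l = 0 := by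
    have : π l = l - C (∑ j : Fin 3, w j * (if j = i then (w i)⁻¹ else 0)) * l := by
      conv_lhs => rw [hl]
      simp only [linForm, map_sum, map_mul, π, algHom_C, aeval_X, mul_sub, Finset.sum_sub_distrib,
        algebraMap_eq]
      rw [← linForm, ← hl, Finset.sum_mul]
      simp only [mul_assoc]
    rw [this]
    simp [hi]
  have hπ1 : ∀ f, ∃ t, π f = f + l * t := by
    intro f
    have h1 : (Ideal.Quotient.mkₐ ℂ (Ideal.span {l})).comp π = Ideal.Quotient.mkₐ ℂ (Ideal.span {l}) := by
      apply MvPolynomial.algHom_ext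
      intro j
      simp only [AlgHom.comp_apply, π, aeval_X, Ideal.Quotient.mkₐ_eq_mk]
      rw [Ideal.Quotient.eq, Ideal.mem_span_singleton]
      exact ⟨-C (if j = i then (w i)⁻¹ else 0), by ring⟩
    have h2 := DFunLike.congr_fun h1 f
    simp only [AlgHom.comp_apply, Ideal.Quotient.mkₐ_eq_mk] at h2
    rw [Ideal.Quotient.eq, Ideal.mem_span_singleton] at h2
    obtain ⟨t, ht⟩ := h2
    exact ⟨t, by rw [← ht]; ring⟩
  have hππ : ∀ f, π (π f) = π f := by
    intro f
    obtain ⟨t, ht⟩ := hπ1 f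
    conv_lhs => rw [ht]
    rw [map_add, map_mul, hπl, zero_mul, add_zero]
  have hker : ∀ f, π f = 0 → ∃ t, f = l * t := by
    intro f hf
    obtain ⟨t, ht⟩ := hπ1 f
    exact ⟨-t, by rw [hf] at ht; linear_combination -ht⟩
  have hπX : ∀ j, j ≠ i → π (X j) = X j := by
    intro j hj
    simp [π, hj]
  -- Nullstellensatz
  have hnull : ∀ j, ∃ n, (X j : MvPolynomial (Fin 3) ℂ) ^ n ∈ Ideal.span {F, Q, l} := by
    intro j
    have : (X j : MvPolynomial (Fin 3) ℂ) ∈ (Ideal.span {F, Q, l}).radical := by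
      rw [← vanishingIdeal_zeroLocus_eq_radical (K := ℂ), mem_vanishingIdeal_iff]
      intro v hv
      have hv' : ∀ p ∈ Ideal.span {F, Q, l}, eval v p = 0 := by
        intro p hp
        have := hv p hp
        simpa [aeval_eq_eval] using this
      have h1 := hv' F (Ideal.subset_span (by simp))
      have h2 := hv' Q (Ideal.subset_span (by simp))
      have h3 := hv' l (Ideal.subset_span (by simp))
      have hv0 : v = 0 := by
        by_contra hne
        exact hav (Projectivization.mk ℂ v hne) (aux_zero_proj hF hne h1) (aux_zero_proj hQ hne h2)
          (aux_zero_proj (aux_lin_hom w) hne h3)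
      simp [hv0]
    exact this
  have hdvd : ∀ d, d ∣ π F → d ∣ π Q → ∀ j, j ≠ i → ∃ n, d ∣ (X j : MvPolynomial (Fin 3) ℂ) ^ n := by
    intro d h1 h2 j hj
    obtain ⟨n, hn⟩ := hnull j
    refine ⟨n, ?_⟩
    obtain ⟨u, z, hz, e⟩ := Ideal.mem_span_insert.1 hn
    obtain ⟨u2, u3, rfl⟩ := Ideal.mem_span_pair.1 hz
    have h3 := congrArg π e
    rw [map_pow, hπX j hj] at h3
    rw [h3]
    simp only [map_add, map_mul, hπl, mul_zero, add_zero]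
    exact dvd_add (h1.mul_left _) (h2.mul_left _)
  have hrel : IsRelPrime (π F) (π Q) := by
    intro d h1 h2
    obtain ⟨j, k, hj, hk, hjk⟩ : ∃ j k : Fin 3, j ≠ i ∧ k ≠ i ∧ j ≠ k := by
      fin_cases i
      · exact ⟨1, 2, by decide⟩
      · exact ⟨0, 2, by decide⟩
      · exact ⟨0, 1, by decide⟩
    obtain ⟨m, hm⟩ := hdvd d h1 h2 j hj
    obtain ⟨n, hn⟩ := hdvd d h1 h2 k hk
    exact aux_X_relprime hjk m n hm hn
  have hnu : ∀ {c : ℕ} {f : MvPolynomial (Fin 3) ℂ}, 1 ≤ c → f.IsHomogeneous c → ¬ IsUnit (π f) := by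
    intro c f hc hf hu
    have h1 : eval (0 : Fin 3 → ℂ) (π f) = 0 := by
      obtain ⟨t, ht⟩ := hπ1 f
      rw [ht, map_add, map_mul]
      have e1 : eval (0 : Fin 3 → ℂ) f = 0 := by
        have := aux_eval_smul hf 0 0
        rw [zero_smul, zero_pow (by omega), zero_mul] at this
        exact this
      have e2 : eval (0 : Fin 3 → ℂ) l = 0 := by rw [hl, aux_eval_lin]; simp
      rw [e1, e2]; ring
    have h2 := hu.map (eval (0 : Fin 3 → ℂ))
    rw [h1] at h2
    exact not_isUnit_zero h2
  have hπF : π F ≠ 0 := by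
    intro h
    apply hnu hb hQ
    rw [h] at hrel
    exact hrel (dvd_zero _) dvd_rfl
  obtain ⟨u, v, huv⟩ := Ideal.mem_span_pair.1 hG
  have e1 : π u * π F + π v * π Q = 0 := by
    rw [← map_mul, ← map_mul, ← map_add, huv, map_mul, hπl, zero_mul]
  have e2 : π F ∣ π v := by
    apply hrel.dvd_of_dvd_mul_right
    exact ⟨-π u, by linear_combination e1⟩
  obtain ⟨t, ht⟩ := e2
  have ht' : π v = π F * π t := by
    have := congrArg π ht
    rwa [hππ, map_mul, hππ] at this
  have hu' : π u = - (π t * π Q) := by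
    apply mul_left_cancel₀ hπF
    rw [ht'] at e1
    linear_combination e1
  obtain ⟨v', hv'⟩ := hker (v - t * F) (by rw [map_sub, map_mul, ht']; ring)
  obtain ⟨u', hu''⟩ := hker (u + t * Q) (by rw [map_add, map_mul, hu']; ring)
  refine Ideal.mem_span_pair.2 ⟨u', v', ?_⟩
  apply mul_left_cancel₀ hl0
  linear_combination huv - F * hu'' - Q * hv'

/-! ### Evaluation and Hilbert functions -/

/-- forms of degree `j` vanishing on `W`. -/
noncomputable def auxI (W : Finset (Proj 2)) (j : ℕ) : Submodule ℂ (MvPolynomial (Fin 3) ℂ) :=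
  (LinearMap.ker (evalMap 2 j W)).map (homogeneousSubmodule (Fin 3) ℂ j).subtype

theorem aux_mem_I {W : Finset (Proj 2)} {j : ℕ} {f : MvPolynomial (Fin 3) ℂ} :
    f ∈ auxI W j ↔ f.IsHomogeneous j ∧ ∀ P ∈ W, eval P.rep f = 0 := by
  constructor
  · rintro ⟨⟨g, hg⟩, h1, rfl⟩
    refine ⟨hg, fun P hP => ?_⟩
    exact congrFun (LinearMap.mem_ker.1 h1) ⟨P, hP⟩
  · rintro ⟨h1, h2⟩
    refine ⟨⟨f, h1⟩, ?_, rfl⟩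
    refine LinearMap.mem_ker.2 (_root_.funext fun P => h2 P.1 P.2)

theorem aux_rank (W : Finset (Proj 2)) (j : ℕ) :
    hilbN 2 W j + Module.finrank ℂ (auxI W j) = (j + 2).choose 2 := by
  rw [← aux_finrank_H j]
  have h := (Submodule.equivMapOfInjective (homogeneousSubmodule (Fin 3) ℂ j).subtype
    (Submodule.subtype_injective _) (LinearMap.ker (evalMap 2 j W))).finrank_eq
  have : Module.Finite ℂ (homogeneousSubmodule (Fin (2 + 1)) ℂ j) := aux_fin_H j
  have h2 := LinearMap.finrank_range_add_finrank_ker (evalMap 2 j W)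
  unfold hilbN auxI
  rw [← h]
  exact h2

theorem aux_I_fin (W : Finset (Proj 2)) (j : ℕ) : Module.Finite ℂ (auxI W j) :=
  aux_fin_sub (j := j) fun _ hf => (aux_mem_I.1 hf).1

theorem aux_hilb_of_surj {W : Finset (Proj 2)} {j : ℕ}
    (h : ∀ y : Proj 2 → ℂ, ∃ f : MvPolynomial (Fin 3) ℂ, f.IsHomogeneous j ∧
      ∀ P ∈ W, eval P.rep f = y P) : hilbN 2 W j = W.card := by
  unfold hilbN
  have : LinearMap.range (evalMap 2 j W) = ⊤ := by
    rw [LinearMap.range_eq_top]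
    intro y
    obtain ⟨f, hf, hf'⟩ := h (fun P => if hP : P ∈ W then y ⟨P, hP⟩ else 0)
    refine ⟨⟨f, hf⟩, _root_.funext fun P => ?_⟩
    have := hf' P.1 P.2
    rw [dif_pos P.2] at this
    exact this
  rw [this, finrank_top]
  simp

theorem aux_surj_of_hilb {W : Finset (Proj 2)} {j : ℕ} (h : hilbN 2 W j = W.card)
    (y : Proj 2 → ℂ) : ∃ f : MvPolynomial (Fin 3) ℂ, f.IsHomogeneous j ∧
      ∀ P ∈ W, eval P.rep f = y P := by
  have : LinearMap.range (evalMap 2 j W) = ⊤ := by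
    apply Submodule.eq_top_of_finrank_eq
    unfold hilbN at h
    rw [h]
    simp
  rw [LinearMap.range_eq_top] at this
  obtain ⟨⟨f, hf⟩, hf'⟩ := this (fun P => y P.1)
  exact ⟨f, hf, fun P hP => congrFun hf' ⟨P, hP⟩⟩

theorem aux_hilb_large (W : Finset (Proj 2)) (j : ℕ) (hj : W.card ≤ j) :
    hilbN 2 W j = W.card := by
  apply aux_hilb_of_surj
  intro y
  choose! s hs using fun P (hP : P ∈ W) => aux_sep_form W P hP j hj
  refine ⟨∑ P ∈ W, C (y P) * s P, IsHomogeneous.sum _ _ _ fun P hP => (hs P hP).1.C_mul _, ?_⟩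
  intro P hP
  rw [map_sum, Finset.sum_eq_single_of_mem P hP]
  · simp [(hs P hP).2.1]
  · intro P' h1 h2
    simp [(hs P' h1).2.2 P hP h2.symm]

theorem aux_J_le_I {F Q : MvPolynomial (Fin 3) ℂ} {W : Finset (Proj 2)}
    (hW : ∀ P ∈ W, eval P.rep F = 0 ∧ eval P.rep Q = 0) (j : ℕ) : auxJ F Q j ≤ auxI W j := by
  intro f hf
  obtain ⟨h1, h2⟩ := aux_mem_J.1 hf
  obtain ⟨u, v, rfl⟩ := Ideal.mem_span_pair.1 h2
  refine aux_mem_I.2 ⟨h1, fun P hP => ?_⟩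
  simp [(hW P hP).1, (hW P hP).2]

/-- Weak Bezout. -/
theorem aux_bezout {a b : ℕ} {F Q : MvPolynomial (Fin 3) ℂ} (hF : F.IsHomogeneous a)
    (hQ : Q.IsHomogeneous b) (hF0 : F ≠ 0) (hQ0 : Q ≠ 0) (h : IsRelPrime F Q)
    (W : Finset (Proj 2)) (hW : ∀ P ∈ W, eval P.rep F = 0 ∧ eval P.rep Q = 0) :
    W.card ≤ a * b := by
  have h1 := aux_finrank_J hF hQ hF0 hQ0 h (a + b + W.card) (by omega)
  have h2 := aux_rank W (a + b + W.card)
  rw [aux_hilb_large W _ (by omega)] at h2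
  have := aux_I_fin W (a + b + W.card)
  have h3 := Submodule.finrank_mono (aux_J_le_I hW (a + b + W.card))
  omega

theorem aux_exists_lin {a b : ℕ} {F Q : MvPolynomial (Fin 3) ℂ} (hF : F.IsHomogeneous a)
    (hQ : Q.IsHomogeneous b) (hF0 : F ≠ 0) (hQ0 : Q ≠ 0) (h : IsRelPrime F Q) :
    ∃ w : Fin 3 → ℂ, w ≠ 0 ∧ ∀ P : Proj 2, eval P.rep F = 0 → eval P.rep Q = 0 →
      eval P.rep (linForm 2 w) ≠ 0 := by
  have hfin : {P : Proj 2 | eval P.rep F = 0 ∧ eval P.rep Q = 0}.Finite := by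
    by_contra hinf
    obtain ⟨W, hW, hc⟩ := Set.Infinite.exists_subset_card_eq hinf (a * b + 1)
    have := aux_bezout hF hQ hF0 hQ0 h W (fun P hP => hW hP)
    omega
  obtain ⟨w, hw, hw'⟩ := aux_avoid hfin.toFinset
  exact ⟨w, hw, fun P h1 h2 => hw' P (by simp [h1, h2])⟩

theorem aux_weights {W : Finset (Proj 2)} {c : Proj 2 → ℂ} {d d0 : ℕ} (hd : d0 ≤ d)
    (hc : ∀ f : MvPolynomial (Fin 3) ℂ, f.IsHomogeneous d → ∑ P ∈ W, c P * eval P.rep f = 0)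
    {w : Fin 3 → ℂ} (hw : ∀ P ∈ W, eval P.rep (linForm 2 w) ≠ 0)
    (h0 : ∀ f : MvPolynomial (Fin 3) ℂ, f.IsHomogeneous (d0 + 1) →
      ∃ g : MvPolynomial (Fin 3) ℂ, g.IsHomogeneous d0 ∧
        ∀ P ∈ W, eval P.rep f = eval P.rep (linForm 2 w) * eval P.rep g) :
    ∀ P ∈ W, c P = 0 := by
  have h1 : ∀ m, ∀ f : MvPolynomial (Fin 3) ℂ, f.IsHomogeneous (d0 + m + 1) →
      ∃ g : MvPolynomial (Fin 3) ℂ, g.IsHomogeneous (d0 + m) ∧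
        ∀ P ∈ W, eval P.rep f = eval P.rep (linForm 2 w) * eval P.rep g := by
    intro m
    induction m with
    | zero => exact h0
    | succ m ih =>
      intro f hf
      have hmon : ∀ e ∈ f.support, ∃ g : MvPolynomial (Fin 3) ℂ, g.IsHomogeneous (d0 + (m + 1)) ∧
        ∀ P ∈ W, eval P.rep (monomial e (coeff e f)) =
          eval P.rep (linForm 2 w) * eval P.rep g := by
        intro e he
        have hdeg : e.degree = d0 + (m + 1) + 1 := by
          by_contra hne
          exact (mem_support_iff.1 he) (hf.coeff_eq_zero hne)
        obtain ⟨i, hi⟩ : ∃ i, e i ≠ 0 := by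
          by_contra! hcon
          have : e = 0 := Finsupp.ext hcon
          rw [this] at hdeg
          simp at hdeg
        have he' : e = Finsupp.single i 1 + (e - Finsupp.single i 1) := by
          rw [add_tsub_cancel_of_le]
          rw [Finsupp.single_le_iff]
          omega
        have hd' : (e - Finsupp.single i 1).degree = d0 + m + 1 := by
          have := congrArg Finsupp.degree he'
          rw [map_add, hdeg, Finsupp.degree_single] at this
          omega
        obtain ⟨g, hg, hg'⟩ := ih (monomial (e - Finsupp.single i 1) (coeff e f))
          (isHomogeneous_monomial _ hd')
        refine ⟨X i * g, ?_, fun P hP => ?_⟩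
        · have := (isHomogeneous_X ℂ i).mul hg
          rwa [show 1 + (d0 + m) = d0 + (m + 1) by omega] at this
        · have : monomial e (coeff e f) = X i * monomial (e - Finsupp.single i 1) (coeff e f) := by
            rw [X, monomial_mul, ← he', one_mul]
          rw [this, map_mul, hg' P hP, map_mul]
          ring
      choose! g hg using hmon
      refine ⟨∑ e ∈ f.support, g e, IsHomogeneous.sum _ _ _ fun e he => (hg e he).1,
        fun P hP => ?_⟩
      conv_lhs => rw [f.as_sum]
      rw [map_sum, map_sum, Finset.mul_sum]
      exact Finset.sum_congr rfl fun e he => (hg e he).2 P hP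
  have h2 : ∀ m, ∀ f : MvPolynomial (Fin 3) ℂ, f.IsHomogeneous (d + m) →
      ∑ P ∈ W, c P * (eval P.rep (linForm 2 w))⁻¹ ^ m * eval P.rep f = 0 := by
    intro m
    induction m with
    | zero => intro f hf; simpa using hc f hf
    | succ m ih =>
      intro f hf
      obtain ⟨g, hg, hg'⟩ := h1 (d - d0 + m) f (by
        rwa [show d0 + (d - d0 + m) + 1 = d + (m + 1) by omega])
      rw [show d0 + (d - d0 + m) = d + m by omega] at hg
      rw [← ih g hg]
      refine Finset.sum_congr rfl fun P hP => ?_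
      rw [hg' P hP]
      have e : (eval P.rep (linForm 2 w))⁻¹ * eval P.rep (linForm 2 w) = 1 :=
        inv_mul_cancel₀ (hw P hP)
      rw [pow_succ]
      linear_combination (c P * (eval P.rep (linForm 2 w))⁻¹ ^ m * eval P.rep g) * e
  intro P hP
  obtain ⟨f, hf, hf1, hf2⟩ := aux_sep_form W P hP (d + W.card) (by omega)
  have h3 := h2 W.card f hf
  rw [Finset.sum_eq_single_of_mem P hP] at h3
  · rw [hf1, mul_one] at h3
    exact (mul_eq_zero.1 h3).resolve_right (pow_ne_zero _ (inv_ne_zero (hw P hP)))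
  · intro P' h4 h5
    rw [hf2 P' h4 h5, mul_zero]

/-- Points on a complete intersection of type `(a,b)` carry no weights in degree `≥ a+b-2`. -/
theorem aux_CI_weights {a b d : ℕ} {F Q : MvPolynomial (Fin 3) ℂ} (hF : F.IsHomogeneous a)
    (hQ : Q.IsHomogeneous b) (hF0 : F ≠ 0) (hQ0 : Q ≠ 0) (h : IsRelPrime F Q)
    (hb : 1 ≤ b) (hd : a + b ≤ d + 2)
    {W : Finset (Proj 2)} {c : Proj 2 → ℂ}
    (hW : ∀ P ∈ W, eval P.rep F = 0 ∧ eval P.rep Q = 0)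
    (hc : ∀ f : MvPolynomial (Fin 3) ℂ, f.IsHomogeneous d → ∑ P ∈ W, c P * eval P.rep f = 0) :
    ∀ P ∈ W, c P = 0 := by
  obtain ⟨w, hw, hav⟩ := aux_exists_lin hF hQ hF0 hQ0 h
  refine aux_weights (w := w) le_rfl hc (fun P hP => hav P (hW P hP).1 (hW P hP).2) ?_
  -- dimension count
  let L : MvPolynomial (Fin 3) ℂ →ₗ[ℂ] MvPolynomial (Fin 3) ℂ :=
    LinearMap.mulLeft ℂ (linForm 2 w : MvPolynomial (Fin 3) ℂ)
  have hLinj : Function.Injective L := mul_right_injective₀ (aux_lin_ne hw)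
  let U : Submodule ℂ (MvPolynomial (Fin 3) ℂ) := (homogeneousSubmodule (Fin 3) ℂ d).map L
  have hU : U ≤ homogeneousSubmodule (Fin 3) ℂ (d + 1) := by
    rintro _ ⟨g, hg, rfl⟩
    have h1 := (aux_lin_hom w).mul hg
    have h2 : (linForm 2 w * g : MvPolynomial (Fin 3) ℂ).IsHomogeneous (d + 1) := by
      rw [Nat.add_comm d 1]; exact h1
    exact h2
  have hUr : Module.finrank ℂ U = (d + 2).choose 2 := by
    rw [← aux_finrank_H d]
    exact (Submodule.equivMapOfInjective L hLinj _).finrank_eq.symm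
  have hinf : U ⊓ auxJ F Q (d + 1) ≤ (auxJ F Q d).map L := by
    rintro _ ⟨⟨g, hg, rfl⟩, h2⟩
    exact ⟨g, aux_mem_J.2 ⟨hg, aux_nzd hF hQ hb hw hav g (aux_mem_J.1 h2).2⟩, rfl⟩
  have hJd : auxJ F Q d ≤ homogeneousSubmodule (Fin 3) ℂ d := inf_le_left
  have hJd1 : auxJ F Q (d + 1) ≤ homogeneousSubmodule (Fin 3) ℂ (d + 1) := inf_le_left
  have i1 : Module.Finite ℂ U := aux_fin_sub hU
  have i2 : Module.Finite ℂ (auxJ F Q d) := aux_fin_sub hJd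
  have i3 : Module.Finite ℂ (auxJ F Q (d + 1)) := aux_fin_sub hJd1
  have r0 : Module.finrank ℂ ((auxJ F Q d).map L) = Module.finrank ℂ (auxJ F Q d) :=
    (Submodule.equivMapOfInjective L hLinj _).finrank_eq.symm
  have r1 := Submodule.finrank_mono hinf
  have r2 := Submodule.finrank_sup_add_finrank_inf_eq U (auxJ F Q (d + 1))
  have r3 := aux_finrank_J hF hQ hF0 hQ0 h d hd
  have r4 := aux_finrank_J hF hQ hF0 hQ0 h (d + 1) (by omega)
  have hsup : U ⊔ auxJ F Q (d + 1) = homogeneousSubmodule (Fin 3) ℂ (d + 1) := by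
    have i4 : Module.Finite ℂ (homogeneousSubmodule (Fin 3) ℂ (d + 1)) := aux_fin_H _
    apply Submodule.eq_of_le_of_finrank_le (sup_le hU hJd1)
    rw [aux_finrank_H]
    omega
  intro f hf
  have hf' : f ∈ U ⊔ auxJ F Q (d + 1) := by rw [hsup]; exact hf
  obtain ⟨_, ⟨g, hg, rfl⟩, j, hj, rfl⟩ := Submodule.mem_sup.1 hf'
  refine ⟨g, hg, fun P hP => ?_⟩
  have := (aux_mem_I.1 (aux_J_le_I hW (d + 1) hj)).2 P hP
  simp [L, this]

/-- Residuation with respect to the common factor of two forms. -/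
theorem aux_residual {p q d : ℕ} {F Q : MvPolynomial (Fin 3) ℂ} (hQ : Q.IsHomogeneous p)
    (hF : F.IsHomogeneous q) (hQ0 : Q ≠ 0) (hndvd : ¬ Q ∣ F) (hpq : p ≤ q) (hpd : p ≤ d)
    {W : Finset (Proj 2)} {c : Proj 2 → ℂ}
    (hW : ∀ P ∈ W, eval P.rep Q = 0 ∧ eval P.rep F = 0)
    (hc : ∀ f : MvPolynomial (Fin 3) ℂ, f.IsHomogeneous d → ∑ P ∈ W, c P * eval P.rep f = 0)
    (hc0 : ∀ P ∈ W, c P ≠ 0) :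
    ∃ (k : ℕ) (G : MvPolynomial (Fin 3) ℂ), k < p ∧ G.IsHomogeneous k ∧ G ≠ 0 ∧
      (k = 0 → IsRelPrime Q F) ∧ (p + q ≤ d + 2 + k → ∀ P ∈ W, eval P.rep G = 0) := by
  have hF0 : F ≠ 0 := by rintro rfl; exact hndvd (dvd_zero _)
  obtain ⟨Q', F', G, hrel, rfl, rfl⟩ := UniqueFactorizationMonoid.exists_reduced_factors Q hQ0 F
  obtain ⟨k, l, hkl, hGk, hQ'⟩ := aux_factor_hom hQ hQ0
  obtain ⟨k', l', hkl', hGk', hF'⟩ := aux_factor_hom hF hF0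
  have hG0 : G ≠ 0 := left_ne_zero_of_mul hQ0
  have hQ'0 : Q' ≠ 0 := right_ne_zero_of_mul hQ0
  have hF'0 : F' ≠ 0 := right_ne_zero_of_mul hF0
  obtain rfl : k = k' := hGk.inj_right hGk' hG0
  have hunit : ∀ {f : MvPolynomial (Fin 3) ℂ}, f.IsHomogeneous 0 → f ≠ 0 → IsUnit f := by
    intro f hf hf0
    rw [← totalDegree_zero_iff_isHomogeneous, totalDegree_eq_zero_iff_eq_C] at hf
    rw [hf]
    refine IsUnit.map C (isUnit_iff_ne_zero.2 ?_)
    intro h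
    rw [h, map_zero] at hf
    exact hf0 hf
  have hl : 1 ≤ l := by
    by_contra hcon
    obtain rfl : l = 0 := by omega
    apply hndvd
    obtain ⟨u, hu⟩ := hunit hQ' hQ'0
    rw [← hu]
    exact mul_dvd_mul_left G (Units.coe_dvd)
  refine ⟨k, G, by omega, hGk, hG0, ?_, ?_⟩
  · rintro rfl
    have hGu := hunit hGk hG0
    exact (isRelPrime_mul_unit_left_left hGu).2 ((isRelPrime_mul_unit_left_right hGu).2 hrel)
  · intro hdeg
    have key := aux_CI_weights (d := d - k) (W := W.filter fun P => eval P.rep G ≠ 0)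
      (c := fun P => c P * eval P.rep G) hQ' hF' hQ'0 hF'0 hrel (by omega) (by omega) ?_ ?_
    · intro P hP
      by_contra hne
      have := key P (Finset.mem_filter.2 ⟨hP, hne⟩)
      exact mul_ne_zero (hc0 P hP) hne this
    · intro P hP
      obtain ⟨h1, h2⟩ := Finset.mem_filter.1 hP
      have h3 := hW P h1
      simp only [map_mul] at h3
      exact ⟨(mul_eq_zero.1 h3.1).resolve_left h2, (mul_eq_zero.1 h3.2).resolve_left h2⟩
    · intro f hf
      have h1 := hGk.mul hf
      rw [show k + (d - k) = d by omega] at h1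
      refine Eq.trans ?_ (hc _ h1)
      rw [Finset.sum_filter]
      refine Finset.sum_congr rfl fun P _ => ?_
      split_ifs with h2
      · rw [map_mul]; ring
      · rw [not_not] at h2
        rw [map_mul, h2]; ring

/-! ### Apolarity and Kruskal rank -/

theorem aux_coeff_vero (d : ℕ) (P : Proj 2) (e : Fin 3 →₀ ℕ) :
    coeff e (vero 2 d P) =
      if e.degree = d then (e.multinomial : ℂ) * eval P.rep (monomial e (1 : ℂ)) else 0 := by
  have h : vero 2 d P = (∑ i : Fin 3, P.rep i • X i : MvPolynomial (Fin 3) ℂ) ^ d := by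
    unfold vero linForm
    simp only [smul_eq_C_mul]
  rw [h, coeff_linearCombination_X_pow_of_fintype, eval_monomial, one_mul]
  rfl

theorem aux_apolar {W : Finset (Proj 2)} {c : Proj 2 → ℂ} {d : ℕ}
    (h : ∑ P ∈ W, c P • vero 2 d P = 0) (f : MvPolynomial (Fin 3) ℂ) (hf : f.IsHomogeneous d) :
    ∑ P ∈ W, c P * eval P.rep f = 0 := by
  have h1 : ∀ e ∈ f.support, ∑ P ∈ W, c P * eval P.rep (monomial e (1 : ℂ)) = 0 := by
    intro e he
    have hdeg : e.degree = d := by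
      by_contra hne
      exact (mem_support_iff.1 he) (hf.coeff_eq_zero hne)
    have h2 := congrArg (coeff e) h
    rw [coeff_sum, coeff_zero] at h2
    have h3 : (e.multinomial : ℂ) * ∑ P ∈ W, c P * eval P.rep (monomial e (1 : ℂ)) = 0 := by
      rw [← h2, Finset.mul_sum]
      refine Finset.sum_congr rfl fun P _ => ?_
      rw [coeff_smul, aux_coeff_vero, if_pos hdeg, smul_eq_mul]
      ring
    refine (mul_eq_zero.1 h3).resolve_left ?_
    exact_mod_cast (Nat.multinomial_pos _ _).ne'
  have h4 : ∀ P : Proj 2, eval P.rep f =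
      ∑ e ∈ f.support, coeff e f * eval P.rep (monomial e (1 : ℂ)) := by
    intro P
    conv_lhs => rw [f.as_sum]
    rw [map_sum]
    refine Finset.sum_congr rfl fun e _ => ?_
    rw [eval_monomial, eval_monomial, one_mul]
  simp only [h4, Finset.mul_sum]
  rw [Finset.sum_comm]
  refine Finset.sum_eq_zero fun e he => ?_
  rw [← mul_zero (coeff e f), ← h1 e he, Finset.mul_sum]
  refine Finset.sum_congr rfl fun P _ => ?_
  ring

theorem aux_apolar_conv {W : Finset (Proj 2)} {c : Proj 2 → ℂ} {d : ℕ}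
    (h : ∀ f : MvPolynomial (Fin 3) ℂ, f.IsHomogeneous d → ∑ P ∈ W, c P * eval P.rep f = 0) :
    ∑ P ∈ W, c P • vero 2 d P = 0 := by
  ext e
  rw [coeff_sum, coeff_zero]
  by_cases hdeg : e.degree = d
  · rw [← mul_zero (e.multinomial : ℂ), ← h _ (isHomogeneous_monomial (1 : ℂ) hdeg),
      Finset.mul_sum]
    refine Finset.sum_congr rfl fun P _ => ?_
    rw [coeff_smul, aux_coeff_vero, if_pos hdeg, smul_eq_mul]
    ring
  · refine Finset.sum_eq_zero fun P _ => ?_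
    rw [coeff_smul, aux_coeff_vero, if_neg hdeg, smul_zero]

theorem aux_dual (W : Finset (Proj 2)) (φ : Module.Dual ℂ (W → ℂ)) :
    ∃ c : Proj 2 → ℂ, (∀ y : Proj 2 → ℂ, φ (fun P => y P.1) = ∑ P ∈ W, c P * y P) ∧
      ((∀ P ∈ W, c P = 0) → φ = 0) := by
  refine ⟨fun P => if hP : P ∈ W then φ (Pi.single ⟨P, hP⟩ 1) else 0, ?_, ?_⟩
  · intro y
    rw [LinearMap.pi_apply_eq_sum_univ φ, ← Finset.sum_coe_sort W]
    refine Finset.sum_congr rfl fun P _ => ?_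
    beta_reduce
    rw [dif_pos P.2, smul_eq_mul, mul_comm]
    congr 2
    funext Q
    simp [Pi.single_apply, eq_comm]
  · intro h
    refine LinearMap.pi_ext' fun P => ?_
    ext
    have := h P.1 P.2
    beta_reduce at this
    rw [dif_pos P.2] at this
    simpa using this

theorem aux_hilb_of_indep {W : Finset (Proj 2)} {d : ℕ}
    (h : LinearIndependent ℂ (fun P : W => vero 2 d P.1)) : hilbN 2 W d = W.card := by
  have hr : LinearMap.range (evalMap 2 d W) = ⊤ := by
    by_contra hne
    obtain ⟨φ, hφ, hle⟩ := Submodule.exists_le_ker_of_lt_top _ (lt_top_iff_ne_top.2 hne)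
    obtain ⟨c, hc, hc0⟩ := aux_dual W φ
    apply hφ
    apply hc0
    have h1 : ∑ P ∈ W, c P • vero 2 d P = 0 := by
      apply aux_apolar_conv
      intro f hf
      rw [← hc (fun P => eval P.rep f)]
      exact hle ⟨⟨f, hf⟩, rfl⟩
    rw [← Finset.sum_coe_sort W] at h1
    have h2 := Fintype.linearIndependent_iff.1 h (fun P => c P.1) h1
    exact fun P hP => h2 ⟨P, hP⟩
  unfold hilbN
  rw [hr, finrank_top]
  simp

theorem aux_kruskal {A : Finset (Proj 2)} (hk : kruskalRank 2 3 A = 10) {W : Finset (Proj 2)}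
    (hW : W ⊆ A) (hWc : W.card ≤ 10) : hilbN 2 W 3 = W.card := by
  apply aux_hilb_of_indep
  have hmem : kruskalRank 2 3 A ∈ {k | k ≤ A.card ∧
    ∀ A' ⊆ A, A'.card ≤ k → LinearIndependent ℂ (fun P : A' => vero 2 3 P.1)} := by
    apply Nat.sSup_mem
    · by_contra hne
      rw [Set.not_nonempty_iff_eq_empty] at hne
      unfold kruskalRank at hk
      rw [hne] at hk
      simp at hk
    · exact ⟨A.card, fun k hk => hk.1⟩
  rw [hk] at hmem
  exact hmem.2 W hW hWc

theorem aux_no_cubic {A : Finset (Proj 2)} (hk : kruskalRank 2 3 A = 10) {W : Finset (Proj 2)}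
    (hW : W ⊆ A) (hWc : 10 ≤ W.card) {k : ℕ} (hk3 : k ≤ 3) {G : MvPolynomial (Fin 3) ℂ}
    (hG : G.IsHomogeneous k) (hv : ∀ P ∈ W, eval P.rep G = 0) : G = 0 := by
  obtain ⟨W', hW', hc⟩ := Finset.exists_subset_card_eq hWc
  have h1 := aux_kruskal hk (hW'.trans hW) hc.le
  have h2 := aux_rank W' 3
  rw [h1, hc] at h2
  have h3 : Module.finrank ℂ (auxI W' 3) = 0 := by
    have : (3 + 2).choose 2 = 10 := rfl
    omega
  have := aux_I_fin W' 3
  have h4 : auxI W' 3 = ⊥ := Submodule.finrank_eq_zero.1 h3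
  have h5 : X 0 ^ (3 - k) * G ∈ auxI W' 3 := by
    refine aux_mem_I.2 ⟨?_, fun P hP => ?_⟩
    · have := ((isHomogeneous_X ℂ (0 : Fin 3)).pow (3 - k)).mul hG
      rwa [show 1 * (3 - k) + k = 3 by omega] at this
    · rw [map_mul, hv P (hW' hP), mul_zero]
  rw [h4, Submodule.mem_bot] at h5
  exact (mul_eq_zero.1 h5).resolve_left (pow_ne_zero _ (X_ne_zero _))

theorem aux_orth {W : Finset (Proj 2)} {c : Proj 2 → ℂ} {i j : ℕ}
    (hc : ∀ f : MvPolynomial (Fin 3) ℂ, f.IsHomogeneous (i + j) →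
      ∑ P ∈ W, c P * eval P.rep f = 0)
    (hc0 : ∀ P ∈ W, c P ≠ 0) : hilbN 2 W i + hilbN 2 W j ≤ W.card := by
  let M : (W → ℂ) →ₗ[ℂ] (W → ℂ) := LinearMap.pi fun P => c P.1 • LinearMap.proj P
  have hM : Function.Injective M := by
    intro x y hxy
    funext P
    have := congrFun hxy P
    exact mul_left_cancel₀ (hc0 P.1 P.2) this
  let D : (W → ℂ) →ₗ[ℂ] Module.Dual ℂ (W → ℂ) := (dotProductEquiv ℂ W).toLinearMap ∘ₗ M
  have hD : Function.Injective D := (dotProductEquiv ℂ W).injective.comp hM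
  have hle : (LinearMap.range (evalMap 2 j W)).map D ≤
      (LinearMap.range (evalMap 2 i W)).dualAnnihilator := by
    rintro _ ⟨_, ⟨⟨f, hf⟩, rfl⟩, rfl⟩
    rw [Submodule.mem_dualAnnihilator]
    rintro _ ⟨⟨g, hg⟩, rfl⟩
    have h1 := hc _ (IsHomogeneous.mul hg hf)
    rw [← h1, ← Finset.sum_coe_sort W]
    refine Finset.sum_congr rfl fun P _ => ?_
    rw [map_mul]
    change c P.1 * eval P.1.rep f * eval P.1.rep g = _
    ring
  have h1 := Submodule.finrank_mono hle
  have h2 := (Submodule.equivMapOfInjective D hD (LinearMap.range (evalMap 2 j W))).finrank_eq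
  have h3 := Subspace.finrank_add_finrank_dualAnnihilator_eq (LinearMap.range (evalMap 2 i W))
  have h4 : Module.finrank ℂ (W → ℂ) = W.card := by simp
  unfold hilbN
  omega

theorem aux_nr {A : Finset (Proj 2)} {T : MvPolynomial (Fin 3) ℂ} {d : ℕ}
    (hA : NRComputes 2 d A T) :
    ∃ a : Proj 2 → ℂ, ∑ P ∈ A, a P • vero 2 d P = T ∧ ∀ P ∈ A, a P ≠ 0 := by
  obtain ⟨h1, h2⟩ := hA
  unfold Computes at h1
  rw [Submodule.mem_span_image_finset_iff_exists_fun'] at h1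
  obtain ⟨a, ha⟩ := h1
  refine ⟨a, ha, fun P hP h0 => ?_⟩
  apply h2 (A.erase P) (Finset.erase_ssubset hP)
  unfold Computes
  rw [Submodule.mem_span_image_finset_iff_exists_fun']
  refine ⟨a, ?_⟩
  rw [← ha, ← Finset.add_sum_erase A _ hP, h0, zero_smul, zero_add]

/-! ### The main argument -/

theorem aux_I_mono {W Z : Finset (Proj 2)} (h : W ⊆ Z) (j : ℕ) : auxI Z j ≤ auxI W j := by
  intro f hf
  obtain ⟨h1, h2⟩ := aux_mem_I.1 hf
  exact aux_mem_I.2 ⟨h1, fun P hP => h2 P (h hP)⟩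

theorem aux_hilb_sub {A W : Finset (Proj 2)} {j : ℕ} (hA : hilbN 2 A j = A.card) (hW : W ⊆ A) :
    hilbN 2 W j = W.card := by
  apply aux_hilb_of_surj
  intro y
  obtain ⟨f, hf, hf'⟩ := aux_surj_of_hilb hA y
  exact ⟨f, hf, fun P hP => hf' P (hW hP)⟩

theorem aux_hilb_mono {W Z : Finset (Proj 2)} (h : W ⊆ Z) (j : ℕ) :
    hilbN 2 W j ≤ hilbN 2 Z j := by
  have h1 := aux_rank W j
  have h2 := aux_rank Z j
  have := aux_I_fin W j
  have h3 := Submodule.finrank_mono (aux_I_mono h j)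
  omega

theorem aux_setup {A B : Finset (Proj 2)} {T : MvPolynomial (Fin 3) ℂ}
    (hA : NRComputes 2 8 A T) (hB : NRComputes 2 8 B T) (hcard : A.card = B.card)
    (hh : hilbN 2 A 4 = A.card) :
    ∃ (Z : Finset (Proj 2)) (c : Proj 2 → ℂ), A \ B ⊆ Z ∧ Z ⊆ A ∪ B ∧
      Z.card = 2 * (A \ B).card ∧ hilbN 2 Z 4 = (A \ B).card ∧ (∀ P ∈ Z, c P ≠ 0) ∧
      ∀ f : MvPolynomial (Fin 3) ℂ, f.IsHomogeneous 8 → ∑ P ∈ Z, c P * eval P.rep f = 0 := by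
  obtain ⟨a, ha, ha0⟩ := aux_nr hA
  obtain ⟨b, hb, hb0⟩ := aux_nr hB
  let c : Proj 2 → ℂ := fun P => (if P ∈ A then a P else 0) - (if P ∈ B then b P else 0)
  let Z := (A ∪ B).filter fun P => c P ≠ 0
  have hc0 : ∀ P ∈ Z, c P ≠ 0 := fun P hP => (Finset.mem_filter.1 hP).2
  have hsum : ∑ P ∈ A ∪ B, c P • vero 2 8 P = 0 := by
    have e1 : ∑ P ∈ A ∪ B, (if P ∈ A then a P else 0) • vero 2 8 P = T := by
      rw [← ha]
      symm
      apply Finset.sum_subset_zero_on_sdiff Finset.subset_union_left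
      · intro P hP
        rw [if_neg (Finset.mem_sdiff.1 hP).2, zero_smul]
      · intro P hP
        rw [if_pos hP]
    have e2 : ∑ P ∈ A ∪ B, (if P ∈ B then b P else 0) • vero 2 8 P = T := by
      rw [← hb]
      symm
      apply Finset.sum_subset_zero_on_sdiff Finset.subset_union_right
      · intro P hP
        rw [if_neg (Finset.mem_sdiff.1 hP).2, zero_smul]
      · intro P hP
        rw [if_pos hP]
    simp only [c, sub_smul, Finset.sum_sub_distrib]
    rw [e1, e2, sub_self]
  have hc : ∀ f : MvPolynomial (Fin 3) ℂ, f.IsHomogeneous 8 →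
      ∑ P ∈ Z, c P * eval P.rep f = 0 := by
    intro f hf
    refine Eq.trans ?_ (aux_apolar hsum f hf)
    apply Finset.sum_subset (Finset.filter_subset _ _)
    intro P h1 h2
    have : c P = 0 := by
      by_contra hne
      exact h2 (Finset.mem_filter.2 ⟨h1, hne⟩)
    rw [this, zero_mul]
  have hAB : A \ B ⊆ Z := by
    intro P hP
    obtain ⟨h1, h2⟩ := Finset.mem_sdiff.1 hP
    refine Finset.mem_filter.2 ⟨Finset.mem_union_left _ h1, ?_⟩
    simp only [c, if_pos h1, if_neg h2, sub_zero]
    exact ha0 P h1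
  have s1 : A \ B ⊆ Z ∩ A := Finset.subset_inter hAB Finset.sdiff_subset
  have s2 : Z \ A ⊆ B \ A := by
    intro P hP
    obtain ⟨h1, h2⟩ := Finset.mem_sdiff.1 hP
    have h3 := Finset.mem_union.1 (Finset.mem_filter.1 h1).1
    exact Finset.mem_sdiff.2 ⟨h3.resolve_left h2, h2⟩
  have k1 := Finset.card_le_card s1
  have k2 := Finset.card_le_card s2
  have k3 := Finset.card_inter_add_card_sdiff Z A
  have k4 : (A \ B).card = (B \ A).card := Finset.card_sdiff_comm hcard
  have k5 := aux_orth (i := 4) (j := 4) hc hc0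
  have k6 := aux_hilb_sub hh (Finset.inter_subset_right : Z ∩ A ⊆ A)
  have k7 := aux_hilb_mono (Finset.inter_subset_left : Z ∩ A ⊆ Z) 4
  exact ⟨Z, c, hAB, Finset.filter_subset _ _, by omega, by omega, hc0, hc⟩

theorem aux_small {A W Z : Finset (Proj 2)} {c : Proj 2 → ℂ} (hk : kruskalRank 2 3 A = 10)
    (hh : hilbN 2 A 4 = A.card) (hWA : W ⊆ A) (hWZ : W ⊆ Z) (hZ : hilbN 2 Z 4 = W.card)
    (hW : W.card ≤ 10)
    (hc : ∀ f : MvPolynomial (Fin 3) ℂ, f.IsHomogeneous 8 → ∑ P ∈ Z, c P * eval P.rep f = 0) :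
    ∀ P ∈ Z, c P = 0 := by
  obtain ⟨w, hw, hw'⟩ := aux_avoid Z
  refine aux_weights (d0 := 3) (by norm_num) hc hw' ?_
  have hI : auxI Z 4 = auxI W 4 := by
    have := aux_I_fin W 4
    apply Submodule.eq_of_le_of_finrank_le (aux_I_mono hWZ 4)
    have h1 := aux_rank W 4
    have h2 := aux_rank Z 4
    have h3 := aux_hilb_sub hh hWA
    omega
  intro f hf
  obtain ⟨g, hg, hg'⟩ := aux_surj_of_hilb (aux_kruskal hk hWA hW)
    (fun P => eval P.rep f / eval P.rep (linForm 2 w))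
  refine ⟨g, hg, fun P hP => ?_⟩
  have hmem : f - linForm 2 w * g ∈ auxI W 4 := by
    refine aux_mem_I.2 ⟨hf.sub ((aux_lin_hom w).mul hg), fun P hP => ?_⟩
    rw [map_sub, map_mul, hg' P hP, mul_div_cancel₀ _ (hw' P (hWZ hP)), sub_self]
  rw [← hI] at hmem
  have := (aux_mem_I.1 hmem).2 P hP
  rw [map_sub, map_mul] at this
  exact sub_eq_zero.1 this

theorem aux_exists_nd {Z : Finset (Proj 2)} {Q : MvPolynomial (Fin 3) ℂ} {a j : ℕ}
    (hQ : Q.IsHomogeneous a) (hQ0 : Q ≠ 0)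
    (h : (j + 2 - a).choose 2 < Module.finrank ℂ (auxI Z j)) : ∃ F ∈ auxI Z j, ¬ Q ∣ F := by
  by_contra! hcon
  have hle : auxI Z j ≤ auxM Q j := fun F hF => aux_mem_M.2 ⟨(aux_mem_I.1 hF).1, hcon F hF⟩
  have : Module.Finite ℂ (auxM Q j) := aux_fin_sub (j := j) fun f hf => (aux_mem_M.1 hf).1
  have h1 := Submodule.finrank_mono hle
  rw [aux_finrank_M hQ hQ0] at h1
  omega

theorem aux_ideal {Z : Finset (Proj 2)} {Q S : MvPolynomial (Fin 3) ℂ} {a b : ℕ}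
    (hQ : Q.IsHomogeneous a) (hS : S.IsHomogeneous b) (hQ0 : Q ≠ 0) (hS0 : S ≠ 0) (hb : 1 ≤ b)
    (hrel : IsRelPrime Q S) (hZ : ∀ P ∈ Z, eval P.rep Q = 0 ∧ eval P.rep S = 0)
    (hcard : Z.card = a * b) (e : ℕ) (F : MvPolynomial (Fin 3) ℂ) (hF : F.IsHomogeneous e)
    (hv : ∀ P ∈ Z, eval P.rep F = 0) : F ∈ Ideal.span {Q, S} := by
  obtain ⟨w, hw, hav⟩ := aux_exists_lin hQ hS hQ0 hS0 hrel
  have hdesc : ∀ N, linForm 2 w ^ N * F ∈ Ideal.span {Q, S} → F ∈ Ideal.span {Q, S} := by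
    intro N
    induction N with
    | zero => intro h; rwa [pow_zero, one_mul] at h
    | succ N ih =>
      intro h
      rw [pow_succ', mul_assoc] at h
      exact ih (aux_nzd hQ hS hb hw hav _ h)
  apply hdesc (a * b + a + b)
  have hI : linForm 2 w ^ (a * b + a + b) * F ∈ auxI Z (a * b + a + b + e) := by
    refine aux_mem_I.2 ⟨?_, fun P hP => ?_⟩
    · have h1 := ((aux_lin_hom w).pow (a * b + a + b)).mul hF
      rw [one_mul] at h1
      exact h1
    · rw [map_mul, hv P hP, mul_zero]
  have heq : auxJ Q S (a * b + a + b + e) = auxI Z (a * b + a + b + e) := by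
    have := aux_I_fin Z (a * b + a + b + e)
    apply Submodule.eq_of_le_of_finrank_le (aux_J_le_I hZ _)
    have h1 := aux_finrank_J hQ hS hQ0 hS0 hrel (a * b + a + b + e) (by omega)
    have h2 := aux_rank Z (a * b + a + b + e)
    rw [aux_hilb_large Z _ (by omega)] at h2
    omega
  rw [← heq] at hI
  exact (aux_mem_J.1 hI).2

/-- Claim: in the degree `8`, length `14` situation, `Z = A ∪ B` is a complete
intersection of type `(4,7)`: there are forms `Q` of degree `4` and `S` of degree `7`
whose common zero locus is exactly `Z` (28 distinct points) and such that every
homogeneous form vanishing on `Z` lies in the ideal `(Q, S)`. -/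
theorem stmt11
    (T : MvPolynomial (Fin 3) ℂ) (hT0 : T ≠ 0) (hTh : T.IsHomogeneous 8)
    (A : Finset (Proj 2)) (hA : NRComputes 2 8 A T) (hAc : A.card = 14)
    (hk : kruskalRank 2 3 A = 10) (hh : hilbN 2 A 4 = 14)
    (B : Finset (Proj 2)) (hB : NRComputes 2 8 B T) (hBc : B.card = 14) (hBA : B ≠ A) :
    ∃ Q S : MvPolynomial (Fin 3) ℂ, Q.IsHomogeneous 4 ∧ S.IsHomogeneous 7 ∧
      (A ∪ B).card = 28 ∧
      {P : Proj 2 | MvPolynomial.eval P.rep Q = 0 ∧ MvPolynomial.eval P.rep S = 0} =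
        ((A ∪ B : Finset (Proj 2)) : Set (Proj 2)) ∧
      ∀ (e : ℕ) (F : MvPolynomial (Fin 3) ℂ), F.IsHomogeneous e →
        (∀ P ∈ A ∪ B, MvPolynomial.eval P.rep F = 0) → F ∈ Ideal.span {Q, S} := by
  have hh' : hilbN 2 A 4 = A.card := by rw [hh, hAc]
  obtain ⟨Z, c, hsub, hZsub, hZc, hZ4, hc0, hc⟩ := aux_setup hA hB (by rw [hAc, hBc]) hh'
  have hmA : A \ B ⊆ A := Finset.sdiff_subset
  have hm14 : (A \ B).card ≤ 14 := hAc ▸ Finset.card_le_card hmA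
  have hm1 : 1 ≤ (A \ B).card := by
    rw [Nat.one_le_iff_ne_zero, Ne, Finset.card_eq_zero, Finset.sdiff_eq_empty_iff_subset]
    intro h
    exact hBA (Finset.eq_of_subset_of_card_le h (by omega)).symm
  have hm10 : 10 < (A \ B).card := by
    by_contra hle
    have h0 := aux_small hk hh' hmA hsub hZ4 (by omega) hc
    obtain ⟨P, hP⟩ := Finset.card_pos.1 hm1
    exact hc0 P (hsub hP) (h0 P (hsub hP))
  have hN : ∀ {k : ℕ} {G : MvPolynomial (Fin 3) ℂ}, k ≤ 3 → G.IsHomogeneous k →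
      (∀ P ∈ Z, eval P.rep G = 0) → G = 0 := fun hk3 hG hv =>
    aux_no_cubic hk hmA (by omega) hk3 hG fun P hP => hv P (hsub hP)
  have r4 := aux_rank Z 4
  have e15 : (4 + 2).choose 2 = 15 := rfl
  obtain ⟨Q, hQI, hQ0⟩ : ∃ Q ∈ auxI Z 4, Q ≠ 0 := by
    apply Submodule.exists_mem_ne_zero_of_ne_bot
    intro h
    rw [h, finrank_bot] at r4
    omega
  obtain ⟨hQ, hQv⟩ := aux_mem_I.1 hQI
  have hm : (A \ B).card = 14 := by
    by_contra hne
    obtain ⟨F, hFI, hnd⟩ := aux_exists_nd (Z := Z) (j := 4) hQ hQ0 (by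
      have : (4 + 2 - 4).choose 2 = 1 := rfl
      omega)
    obtain ⟨hF, hFv⟩ := aux_mem_I.1 hFI
    obtain ⟨k, G, hk4, hG, hG0, -, hGv⟩ := aux_residual hQ hF hQ0 hnd le_rfl (by norm_num)
      (fun P hP => ⟨hQv P hP, hFv P hP⟩) hc hc0
    exact hG0 (hN (by omega) hG (hGv (by omega)))
  have hcard : (A ∪ B).card ≤ 28 := (Finset.card_union_le A B).trans (by omega)
  have hZeq : Z = A ∪ B := Finset.eq_of_subset_of_card_le hZsub (by omega)
  have r1 := aux_rank Z 1
  have hI1 : auxI Z 1 = ⊥ := by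
    rw [eq_bot_iff]
    intro f hf
    obtain ⟨h1, h2⟩ := aux_mem_I.1 hf
    exact (Submodule.mem_bot ℂ).2 (hN (by norm_num) h1 h2)
  rw [hI1, finrank_bot] at r1
  have e3 : (1 + 2).choose 2 = 3 := rfl
  have ho := aux_orth (i := 1) (j := 7) hc hc0
  have r7 := aux_rank Z 7
  have e36 : (7 + 2).choose 2 = 36 := rfl
  obtain ⟨S, hSI, hnd⟩ := aux_exists_nd (Z := Z) (j := 7) hQ hQ0 (by
    have : (7 + 2 - 4).choose 2 = 10 := rfl
    omega)
  obtain ⟨hS, hSv⟩ := aux_mem_I.1 hSI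
  have hS0 : S ≠ 0 := by rintro rfl; exact hnd (dvd_zero _)
  have hv : ∀ P ∈ Z, eval P.rep Q = 0 ∧ eval P.rep S = 0 := fun P hP => ⟨hQv P hP, hSv P hP⟩
  obtain ⟨k, G, hk4, hG, hG0, hrel, hGv⟩ := aux_residual hQ hS hQ0 hnd (by norm_num) (by norm_num)
    hv hc hc0
  have hk0 : k = 0 := by
    by_contra hne
    exact hG0 (hN (by omega) hG (hGv (by omega)))
  have hrel := hrel hk0
  rw [← hZeq]
  refine ⟨Q, S, hQ, hS, by omega, ?_, ?_⟩
  · ext P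
    constructor
    · rintro ⟨h1, h2⟩
      by_contra hP
      have hP' : P ∉ Z := fun h => hP (Finset.mem_coe.2 h)
      have h3 := aux_bezout hQ hS hQ0 hS0 hrel (insert P Z) (by
        intro R hR
        rcases Finset.mem_insert.1 hR with rfl | hR
        · exact ⟨h1, h2⟩
        · exact hv R hR)
      rw [Finset.card_insert_of_notMem hP'] at h3
      omega
    · intro hP
      exact hv P (Finset.mem_coe.1 hP)
  · intro e F hF hFv
    exact aux_ideal hQ hS hQ0 hS0 (by norm_num) hrel hv (by omega) e F hF hFv
end
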